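/- arXiv:2601.21442 — 4 statements merged into one kernel-verified Lean document; each statement's English description precedes it below -/
import Mathlib

section
/- Fix a positive integer d and a tuple of non-negative integers w = (w_0, …, w_{d-1}) with w_{d-1} ≥ 1; let W = max{w_0, …, w_{d-1}} and let c = c_w be the unique positive real root of P_w. Let {a_n}_{n=1}^∞ and {b_n}_{n=1}^∞ be sequences of positive integers with {a_n} monotonically increasing, satisfying: there exist reals 0 < η < τ with b_n ≤ n^η and a_n^{w_0}⋯a_{n+d-1}^{w_{d-1}} ≥ n^{1+τ} for all n, and limsup_{n→∞} a_n^{1/c^n} = ∞. For n ≥ d set x_n = a_{n-d+1}^{w_0} a_{n-d+2}^{w_1} ⋯ a_n^{w_{d-1}} and y_n = b_{n-d+1}, and for N ∈ ℕ set D_N = ∏_{k=1}^N a_k^W and r_N = ∑_{n=max(N+1,d)}^∞ y_n/x_n. Then liminf_{N→∞} D_N · r_N = 0. -/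
open Filter Topology

theorem sum_Icc_pow_le {c : ℝ} (hc : 1 < c) (N : ℕ) :
    ∑ k ∈ Finset.Icc 1 N, c ^ k ≤ c ^ (N + 1) / (c - 1) := by
  have h : 0 < c - 1 := by linarith
  induction N with
  | zero => simp; positivity
  | succ N ih =>
    rw [Finset.sum_Icc_succ_top (by omega)]
    have : c ^ (N + 1 + 1) / (c - 1) = c ^ (N + 1) / (c - 1) + c ^ (N + 1) := by
      field_simp; ring
    linarith

theorem one_lt_of_root {d : ℕ} (hd : 0 < d) {w : ℕ → ℕ} (hw : 1 ≤ w (d - 1)) {c : ℝ} (hc : 0 < c)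
    (hroot : (c - 1) * ∑ j ∈ Finset.range d, (w j : ℝ) * c ^ j
        - (((Finset.range d).sup w : ℕ) : ℝ) * c ^ (d - 1) = 0) : 1 < c := by
  have hW : 1 ≤ (Finset.range d).sup w :=
    hw.trans (Finset.le_sup (f := w) (Finset.mem_range.2 (by omega)))
  have hW' : (1 : ℝ) ≤ (((Finset.range d).sup w : ℕ) : ℝ) := by exact_mod_cast hW
  have h1 : 0 ≤ ∑ j ∈ Finset.range d, (w j : ℝ) * c ^ j :=
    Finset.sum_nonneg fun j _ => by positivity
  have h2 : 0 < c ^ (d - 1) := by positivity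
  by_contra! h
  nlinarith [mul_nonneg (sub_nonneg.2 h) h1]

/-- Discrete Grönwall-type comparison with the critical growth rate `c`. -/
theorem le_of_critical_recursion {d : ℕ} (hd : 0 < d) {w : ℕ → ℕ} (hw : 1 ≤ w (d - 1))
    {c : ℝ} (hc : 1 < c) {W : ℝ} (hW : ∀ j < d, (w j : ℝ) ≤ W)
    (hroot : (c - 1) * ∑ j ∈ Finset.range d, (w j : ℝ) * c ^ j = W * c ^ (d - 1))
    {A σ : ℕ → ℝ} (hA : ∀ k, 0 ≤ A k) (hσ : ∀ k, 0 ≤ σ k) {n P : ℕ} (hdn : d ≤ n)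
    (hrec : ∀ N, n ≤ N → N < P →
      ∑ j ∈ Finset.range d, w j * A (N + 2 - d + j) ≤ W * ∑ k ∈ Finset.Icc 1 N, A k + σ N)
    (k : ℕ) (hnk : n < k) (hkP : k ≤ P) :
    A k ≤ (∑ i ∈ Finset.Ico n k, (σ i + W * ∑ k ∈ Finset.Icc 1 n, A k) / c ^ (i + 1)) * c ^ k := by
  set S := ∑ k ∈ Finset.Icc 1 n, A k with hS
  have hS0 : 0 ≤ S := Finset.sum_nonneg fun i _ => hA i
  have hW0 : 0 ≤ W := (Nat.cast_nonneg _).trans (hW 0 hd)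
  have hc0 : 0 < c := by linarith
  have hc1 : 0 < c - 1 := by linarith
  have hpos : ∀ i, 0 ≤ (σ i + W * S) / c ^ (i + 1) := fun i => by
    have := hσ i
    positivity
  induction k using Nat.strong_induction_on with
  | _ k ih =>
  obtain ⟨N, rfl⟩ : ∃ N, k = N + 1 := ⟨k - 1, by omega⟩
  rw [Finset.sum_Ico_succ_top (by omega), add_mul, div_mul_cancel₀ _ (by positivity)]
  set l := ∑ i ∈ Finset.Ico n N, (σ i + W * S) / c ^ (i + 1) with hl
  have hl0 : 0 ≤ l := Finset.sum_nonneg fun i _ => hpos i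
  let E : ℕ → ℝ := fun i => if i ≤ n then A i else 0
  have hE0 : ∀ i, 0 ≤ E i := fun i => by
    dsimp only [E]; split_ifs
    exacts [hA i, le_rfl]
  have hg : ∀ i, i ≤ N → 0 ≤ l * c ^ i + E i - A i := by
    intro i hi
    dsimp only [E]
    split_ifs with h
    · have : 0 ≤ l * c ^ i := by positivity
      linarith
    · have h1 := ih i (by omega) (by omega) (by omega)
      have h2 : ∑ i ∈ Finset.Ico n i, (σ i + W * S) / c ^ (i + 1) ≤ l :=
        Finset.sum_le_sum_of_subset_of_nonneg (Finset.Ico_subset_Ico_right hi)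
          fun i _ _ => hpos i
      have := mul_le_mul_of_nonneg_right h2 (by positivity : 0 ≤ c ^ i)
      linarith
  obtain ⟨e, rfl⟩ : ∃ e, d = e + 1 := ⟨d - 1, by omega⟩
  have hidx : ∀ j, N + 2 - (e + 1) + j = (N + 1 - e) + j := fun j => by omega
  have hr := hrec N (by omega) (by omega)
  simp only [hidx, Finset.sum_range_succ] at hr
  rw [show N + 1 - e + e = N + 1 by omega] at hr
  have hsumE : ∑ i ∈ Finset.Icc 1 N, E i = S := by
    rw [hS]
    symm
    apply Finset.sum_subset_zero_on_sdiff (Finset.Icc_subset_Icc_right (by omega))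
    · intro i hi
      simp only [Finset.mem_sdiff, Finset.mem_Icc] at hi
      exact if_neg (by omega)
    · intro i hi
      exact (if_pos (Finset.mem_Icc.1 hi).2).symm
  have hwin : ∑ j ∈ Finset.range e, w j * (l * c ^ (N + 1 - e + j) + E (N + 1 - e + j)
      - A (N + 1 - e + j)) ≤ W * ∑ i ∈ Finset.Icc 1 N, (l * c ^ i + E i - A i) := by
    calc _ ≤ ∑ j ∈ Finset.range e, W * (l * c ^ (N + 1 - e + j) + E (N + 1 - e + j)
      - A (N + 1 - e + j)) := by
          apply Finset.sum_le_sum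
          intro j hj
          have := Finset.mem_range.1 hj
          exact mul_le_mul_of_nonneg_right (hW j (by omega)) (hg _ (by omega))
      _ = W * ∑ i ∈ Finset.Ico (N + 1 - e) (N + 1), (l * c ^ i + E i - A i) := by
          rw [← Finset.mul_sum, Finset.sum_Ico_eq_sum_range, show N + 1 - (N + 1 - e) = e by omega]
      _ ≤ _ := by
          apply mul_le_mul_of_nonneg_left _ hW0
          apply Finset.sum_le_sum_of_subset_of_nonneg
          · intro i
            simp only [Finset.mem_Ico, Finset.mem_Icc]
            omega
          · intro i hi _
            exact hg i (Finset.mem_Icc.1 hi).2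
  have hwinE : 0 ≤ ∑ j ∈ Finset.range e, (w j : ℝ) * E (N + 1 - e + j) :=
    Finset.sum_nonneg fun j _ => mul_nonneg (Nat.cast_nonneg _) (hE0 _)
  simp only [mul_sub, mul_add, Finset.sum_sub_distrib, Finset.sum_add_distrib,
    ← Finset.mul_sum, hsumE] at hwin
  have hgeo : W * ∑ i ∈ Finset.Icc 1 N, c ^ i ≤
      ∑ j ∈ Finset.range e, w j * c ^ (N + 1 - e + j) + w e * c ^ (N + 1) := by
    have h1 := mul_le_mul_of_nonneg_left (sum_Icc_pow_le hc N) hW0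
    refine h1.trans (le_of_eq ?_)
    rw [Nat.add_sub_cancel] at hroot
    have h2 : c ^ (N + 1) = c ^ (N + 1 - e) * c ^ e := by rw [← pow_add]; congr 1; omega
    have h3 : ∑ j ∈ Finset.range e, w j * c ^ (N + 1 - e + j) + w e * c ^ (N + 1)
        = c ^ (N + 1 - e) * ∑ j ∈ Finset.range (e + 1), (w j : ℝ) * c ^ j := by
      rw [Finset.sum_range_succ, mul_add, Finset.mul_sum, h2]
      congr 1
      · exact Finset.sum_congr rfl fun j _ => by rw [pow_add]; ring
      · ring
    rw [h3, mul_div_assoc', div_eq_iff hc1.ne', h2]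
    linear_combination (-c ^ (N + 1 - e)) * hroot
  have hgeo' := mul_le_mul_of_nonneg_left hgeo hl0
  have hcomm : ∑ j ∈ Finset.range e, (w j : ℝ) * (l * c ^ (N + 1 - e + j)) =
      l * ∑ j ∈ Finset.range e, (w j : ℝ) * c ^ (N + 1 - e + j) := by
    rw [Finset.mul_sum]
    exact Finset.sum_congr rfl fun j _ => by ring
  rw [hcomm] at hwin
  have hfin : w e * A (N + 1) ≤ w e * (l * c ^ (N + 1)) + (σ N + W * S) := by linarith
  rw [Nat.add_sub_cancel] at hw
  have hw' : (1 : ℝ) ≤ w e := by exact_mod_cast hw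
  have : 0 ≤ σ N + W * S := by have := hσ N; positivity
  by_contra! hcon
  nlinarith

theorem pow_mul_exp_neg_le (p : ℕ) {X Y t : ℝ} (hX : 0 ≤ X) (hXY : X ≤ Y) (ht : 0 ≤ t)
    (htY : t ≤ Y) :
    t ^ p * Real.exp (-Y) ≤ Real.exp 1 * p.factorial * (1 + X) ^ p * Real.exp (-X) := by
  have h1X : 0 < 1 + X := by linarith
  have h1 : (t / (1 + X)) ^ p ≤ p.factorial * Real.exp (t / (1 + X)) := by
    have := Real.pow_div_factorial_le_exp (t / (1 + X)) (by positivity) p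
    rwa [div_le_iff₀ (by positivity), mul_comm] at this
  have h2 : -Y ≤ 1 - X - t / (1 + X) := by
    have : t / (1 + X) ≤ 1 - X + Y := by
      rw [div_le_iff₀ h1X]
      nlinarith
    linarith
  have h3 : t ^ p = (1 + X) ^ p * (t / (1 + X)) ^ p := by
    rw [← mul_pow, mul_div_cancel₀ _ h1X.ne']
  calc t ^ p * Real.exp (-Y)
      ≤ (1 + X) ^ p * (p.factorial * Real.exp (t / (1 + X)))
          * Real.exp (1 - X - t / (1 + X)) := by
        rw [h3]
        gcongr
    _ = _ := by
        rw [show 1 - X - t / (1 + X) = 1 + -X + -(t / (1 + X)) by ring, Real.exp_add,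
          Real.exp_add, Real.exp_neg (t / (1 + X))]
        field_simp

theorem exists_sq_le_mul_pow {r : ℝ} (hr : 1 < r) :
    ∃ M : ℝ, 0 ≤ M ∧ ∀ n : ℕ, (n : ℝ) ^ 2 ≤ M * r ^ n := by
  obtain ⟨M, hM⟩ := (tendsto_pow_const_div_const_pow_of_one_lt 2 hr).bddAbove_range
  have h : ∀ n : ℕ, (n : ℝ) ^ 2 / r ^ n ≤ M := fun n => hM ⟨n, rfl⟩
  refine ⟨M, by simpa using h 0, fun n => ?_⟩
  have := h n
  rwa [div_le_iff₀ (by positivity)] at this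

theorem le_weighted_sum {d : ℕ} (hd : 0 < d) {w : ℕ → ℕ} (hw : 1 ≤ w (d - 1)) {A : ℕ → ℝ}
    (hA : ∀ k, 0 ≤ A k) (k : ℕ) :
    A (k + (d - 1)) ≤ ∑ j ∈ Finset.range d, w j * A (k + j) := by
  have h1 : (w (d - 1) : ℝ) * A (k + (d - 1)) ≤ ∑ j ∈ Finset.range d, w j * A (k + j) :=
    Finset.single_le_sum (f := fun j => (w j : ℝ) * A (k + j))
      (fun j _ => mul_nonneg (Nat.cast_nonneg _) (hA _)) (Finset.mem_range.2 (by omega))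
  have h2 : (1 : ℝ) ≤ w (d - 1) := by exact_mod_cast hw
  exact (le_mul_of_one_le_left (hA _) h2).trans h1

theorem exists_sum_le_of_critical_recursion {d : ℕ} (hd : 0 < d) {w : ℕ → ℕ} (hw : 1 ≤ w (d - 1))
    {c : ℝ} (hc : 1 < c) {W : ℝ} (hW : ∀ j < d, (w j : ℝ) ≤ W)
    (hroot : (c - 1) * ∑ j ∈ Finset.range d, (w j : ℝ) * c ^ j = W * c ^ (d - 1))
    {A : ℕ → ℝ} (hA : ∀ k, 0 ≤ A k) (hmono : ∀ i j, 1 ≤ i → i ≤ j → A i ≤ A j)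
    {C₀ C₁ p : ℝ} (hC₀ : 0 ≤ C₀) (hC₁ : 0 ≤ C₁) (hp : 0 ≤ p) :
    ∃ B : ℝ, 0 ≤ B ∧ ∀ Λ : ℝ, 1 ≤ Λ → ∀ n P : ℕ, d ≤ n → n ≤ P → A n ≤ n + C₀ →
      (∀ N, n ≤ N → N < P → ∑ j ∈ Finset.range d, w j * A (N + 2 - d + j) ≤
        W * ∑ k ∈ Finset.Icc 1 N, A k + (C₁ + p * Real.log Λ + p * N * Real.log c)) →
      ∑ k ∈ Finset.Icc 1 P, A k ≤ B * (1 + Real.log Λ) * c ^ P := by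
  have hc0 : 0 < c := by linarith
  have hc1 : 0 < c - 1 := by linarith
  have hW0 : 0 ≤ W := (Nat.cast_nonneg _).trans (hW 0 hd)
  have hlogc : 0 ≤ Real.log c := Real.log_nonneg hc.le
  set ρ := √c with hρ
  have hρ1 : 1 < ρ := by rw [hρ, Real.lt_sqrt zero_le_one]; simpa using hc
  have hρρ : ρ * ρ = c := Real.mul_self_sqrt hc0.le
  have hρc : ρ < c := by nlinarith
  obtain ⟨M, hM0, hM⟩ := exists_sq_le_mul_pow hρ1
  set B₀ := C₁ + p + (p * Real.log c + W * (1 + C₀)) * M with hB₀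
  have hB₀0 : 0 ≤ B₀ := by positivity
  set Q := B₀ * (1 - ρ / c)⁻¹ with hQ
  have hκ : 0 < 1 - ρ / c := by
    have : ρ / c < 1 := (div_lt_one hc0).2 hρc
    linarith
  have hQ0 : 0 ≤ Q := by positivity
  refine ⟨(1 + C₀) * M + Q * (c / (c - 1)), by positivity, ?_⟩
  intro Λ hΛ n P hdn hnP hAn hrec
  have hl : 0 ≤ Real.log Λ := Real.log_nonneg hΛ
  have hSn : ∑ k ∈ Finset.Icc 1 n, A k ≤ (1 + C₀) * (n : ℝ) ^ 2 := by
    have h1 : ∑ k ∈ Finset.Icc 1 n, A k ≤ ∑ k ∈ Finset.Icc 1 n, (n + C₀) := by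
      apply Finset.sum_le_sum
      intro k hk
      rw [Finset.mem_Icc] at hk
      exact (hmono k n hk.1 hk.2).trans hAn
    have h2 : (1 : ℝ) ≤ n := by exact_mod_cast hd.trans_le hdn
    simp only [Finset.sum_const, Nat.card_Icc, Nat.add_sub_cancel, nsmul_eq_mul] at h1
    nlinarith [mul_nonneg hC₀ (by positivity : (0 : ℝ) ≤ n)]
  have hslack : ∀ i : ℕ, n ≤ i → C₁ + p * Real.log Λ + p * i * Real.log c
      + W * ∑ k ∈ Finset.Icc 1 n, A k ≤ (1 + Real.log Λ) * B₀ * ρ ^ i := by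
    intro i hi
    have hi1 : (1 : ℝ) ≤ i := by exact_mod_cast (hd.trans_le hdn).trans_le hi
    have hni : (n : ℝ) ≤ i := by exact_mod_cast hi
    have hni2 : (n : ℝ) ^ 2 ≤ (i : ℝ) ^ 2 := by gcongr
    have hρi : 1 ≤ ρ ^ i := one_le_pow₀ hρ1.le
    have hii : (i : ℝ) ≤ (i : ℝ) ^ 2 := by nlinarith
    have e1 : W * ∑ k ∈ Finset.Icc 1 n, A k ≤ W * ((1 + C₀) * (M * ρ ^ i)) := by
      gcongr
      refine hSn.trans ?_
      gcongr
      exact hni2.trans (hM i)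
    have e2 : p * i * Real.log c ≤ p * (M * ρ ^ i) * Real.log c := by
      gcongr
      exact hii.trans (hM i)
    have e3 : C₁ + p * Real.log Λ ≤ (1 + Real.log Λ) * (C₁ + p) * ρ ^ i := by
      calc C₁ + p * Real.log Λ ≤ (1 + Real.log Λ) * (C₁ + p) := by nlinarith
        _ ≤ _ := le_mul_of_one_le_right (by positivity) hρi
    have e4 : (p * Real.log c + W * (1 + C₀)) * M * ρ ^ i ≤
        (1 + Real.log Λ) * ((p * Real.log c + W * (1 + C₀)) * M * ρ ^ i) :=
      le_mul_of_one_le_left (by positivity) (by linarith)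
    rw [hB₀]
    linarith
  have hAk : ∀ k, n < k → k ≤ P → A k ≤ (1 + Real.log Λ) * Q * c ^ k := by
    intro k hnk hkP
    refine (le_of_critical_recursion hd hw hc hW hroot hA (fun i => by positivity) hdn hrec
      k hnk hkP).trans ?_
    gcongr
    calc _ ≤ ∑ i ∈ Finset.Ico n k, (1 + Real.log Λ) * B₀ * (ρ / c) ^ i := by
          apply Finset.sum_le_sum
          intro i hi
          rw [Finset.mem_Ico] at hi
          rw [div_le_iff₀ (by positivity)]
          refine (hslack i hi.1).trans ?_
          rw [div_pow, pow_succ]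
          have : (1 + Real.log Λ) * B₀ * (ρ ^ i / c ^ i) * (c ^ i * c) =
            (1 + Real.log Λ) * B₀ * ρ ^ i * c := by field_simp
          rw [this]
          exact le_mul_of_one_le_right (by positivity) hc.le
      _ ≤ (1 + Real.log Λ) * Q := by
          rw [← Finset.mul_sum, hQ, mul_assoc (1 + Real.log Λ)]
          gcongr
          have hs := summable_geometric_of_lt_one (by positivity : 0 ≤ ρ / c)
            ((div_lt_one hc0).2 hρc)
          rw [← tsum_geometric_of_lt_one (by positivity : 0 ≤ ρ / c) ((div_lt_one hc0).2 hρc)]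
          exact hs.sum_le_tsum _ fun i _ => by positivity
  have hsplit : ∑ k ∈ Finset.Icc 1 P, A k =
      ∑ k ∈ Finset.Icc 1 n, A k + ∑ k ∈ Finset.Ioc n P, A k := by
    have h := Finset.sum_Ioc_consecutive A (Nat.zero_le n) hnP
    rw [← Finset.Icc_add_one_left_eq_Ioc 0 n, ← Finset.Icc_add_one_left_eq_Ioc 0 P] at h
    exact h.symm
  have h1 : ∑ k ∈ Finset.Ioc n P, A k ≤ (1 + Real.log Λ) * Q * (c ^ (P + 1) / (c - 1)) := by
    calc _ ≤ ∑ k ∈ Finset.Ioc n P, (1 + Real.log Λ) * Q * c ^ k := by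
          apply Finset.sum_le_sum
          intro k hk
          rw [Finset.mem_Ioc] at hk
          exact hAk k hk.1 hk.2
      _ ≤ ∑ k ∈ Finset.Icc 1 P, (1 + Real.log Λ) * Q * c ^ k := by
          apply Finset.sum_le_sum_of_subset_of_nonneg
          · intro k
            simp only [Finset.mem_Ioc, Finset.mem_Icc]
            omega
          · intros
            positivity
      _ ≤ _ := by
          rw [← Finset.mul_sum]
          gcongr
          exact sum_Icc_pow_le hc P
  have h2 : ∑ k ∈ Finset.Icc 1 n, A k ≤ (1 + Real.log Λ) * ((1 + C₀) * M * c ^ P) := by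
    have : ρ ^ n ≤ c ^ P := (pow_le_pow_left₀ (by positivity) hρc.le n).trans
      (pow_le_pow_right₀ hc.le hnP)
    calc _ ≤ (1 + C₀) * (M * c ^ P) := by
          refine hSn.trans ?_
          gcongr
          exact (hM n).trans (by gcongr)
      _ = (1 + C₀) * M * c ^ P := by ring
      _ ≤ _ := le_mul_of_one_le_left (by positivity) (by linarith)
  rw [hsplit]
  refine (add_le_add h2 h1).trans (le_of_eq ?_)
  rw [pow_succ]
  field_simp

theorem add_le_pow_mul_of_step {S : ℕ → ℝ} {K C : ℝ} (hK : 2 ≤ K) (hC : 0 ≤ C) {P : ℕ}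
    (h : ∀ N, P ≤ N → S (N + 1) ≤ K * S N + C) (t : ℕ) :
    S (P + t) + C ≤ K ^ t * (S P + C) := by
  induction t with
  | zero => simp
  | succ t ih =>
    have h1 := h (P + t) (by omega)
    rw [pow_succ, ← add_assoc]
    nlinarith

theorem exists_last_le {A : ℕ → ℝ} {N₀ : ℕ} (hA : 0 ≤ A N₀) (m : ℕ) (hm : N₀ < m) :
    ∃ n, N₀ ≤ n ∧ n < m ∧ A n ≤ n + A N₀ ∧ ∀ k, n < k → k < m → (k : ℝ) ≤ A k := by
  induction m, hm using Nat.le_induction with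
  | base => exact ⟨N₀, le_rfl, by omega, by simp, fun k h1 h2 => by omega⟩
  | succ m hm ih =>
    rcases le_total (A m) m with h | h
    · exact ⟨m, by omega, by omega, by linarith, fun k h1 h2 => by omega⟩
    · obtain ⟨n, h1, h2, h3, h4⟩ := ih
      refine ⟨n, h1, by omega, h3, fun k hk hkm => ?_⟩
      rcases Nat.lt_succ_iff_lt_or_eq.1 hkm with h5 | rfl
      exacts [h4 k hk h5, h]

/-- Up to shortly before the first time `m` at which `A m ≥ Λ c ^ m`, a lower bound on the
normalized remainder forces the critical recursion up to a slack of order `N + log Λ`. -/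
theorem exists_critical_recursion_of_remainder_ge {d : ℕ} (hd : 0 < d) {w : ℕ → ℕ}
    (hw : 1 ≤ w (d - 1)) {c : ℝ} (hc : 1 < c) {W : ℝ} (hW : ∀ j < d, (w j : ℝ) ≤ W)
    {A y L : ℕ → ℝ} (hA : ∀ k, 0 ≤ A k) (hmono : ∀ i j, 1 ≤ i → i ≤ j → A i ≤ A j)
    (hL : ∀ k, L k = ∑ j ∈ Finset.range d, w j * A (k + j))
    {q : ℕ} (hy : ∀ k, 1 ≤ k → y k ≤ (k : ℝ) ^ q) {C δ ε : ℝ} (hC : 0 < C) (hδ : 0 < δ)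
    (hε : 0 < ε)
    (hsum : ∀ M, 1 ≤ M → Summable fun i => y (M + i) * Real.exp (-L (M + i)))
    (htail : ∀ M, 1 ≤ M → ∑' i, y (M + i) * Real.exp (-L (M + i)) ≤ C * Real.exp (-(δ * L M))) :
    ∃ (T : ℕ) (C₁ Λ₀ : ℝ), 1 ≤ T ∧ 0 ≤ C₁ ∧ ∀ Λ : ℝ, 1 ≤ Λ → Λ₀ ≤ Λ → ∀ n m N : ℕ, d ≤ n → n ≤ N →
      N + 1 + T ≤ m →
      (∀ k, 1 ≤ k → k < m → A k ≤ Λ * c ^ k) → Λ * c ^ m ≤ A m →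
      (∀ k, n < k → k < m → (k : ℝ) ≤ A k) →
      ε ≤ Real.exp (W * ∑ k ∈ Finset.Icc 1 N, A k) *
        ∑' i, y (N + 2 - d + i) * Real.exp (-L (N + 2 - d + i)) →
      L (N + 2 - d) ≤ W * ∑ k ∈ Finset.Icc 1 N, A k +
        (C₁ + (q + 2 : ℕ) * Real.log Λ + (q + 2 : ℕ) * N * Real.log c) := by
  have hc0 : 0 < c := by linarith
  have hc1 : 0 < c - 1 := by linarith
  have hW0 : 0 ≤ W := (Nat.cast_nonneg _).trans (hW 0 hd)
  have hL0 : ∀ k, 0 ≤ L k := fun k => by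
    rw [hL]
    exact Finset.sum_nonneg fun j _ => mul_nonneg (Nat.cast_nonneg _) (hA _)
  have hLmono : ∀ i j, 1 ≤ i → i ≤ j → L i ≤ L j := fun i j hi hij => by
    rw [hL, hL]
    exact Finset.sum_le_sum fun l _ =>
      mul_le_mul_of_nonneg_left (hmono _ _ (by omega) (by omega)) (Nat.cast_nonneg _)
  have hAL : ∀ k, A (k + (d - 1)) ≤ L k := fun k => by
    rw [hL]
    exact le_weighted_sum hd hw hA k
  obtain ⟨T, hT⟩ : ∃ T : ℕ, W / (c - 1) ≤ δ / 2 * c ^ T := by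
    obtain ⟨T, hT⟩ := pow_unbounded_of_one_lt (W / (c - 1) / (δ / 2)) hc
    refine ⟨T, ?_⟩
    rw [div_lt_iff₀ (by positivity)] at hT
    linarith
  set p := q + 2 with hp
  set Z := ∑' k : ℕ, 1 / (k : ℝ) ^ 2 with hZ
  have hZs : Summable fun k : ℕ => 1 / (k : ℝ) ^ 2 :=
    Real.summable_one_div_nat_pow.2 one_lt_two
  have hZ0 : 0 ≤ Z := tsum_nonneg fun k => by positivity
  set G := 2 / ε * (Real.exp 1 * p.factorial * (1 + d * W * c) ^ p * (1 + Z)) with hG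
  have hG0 : 0 < G := by positivity
  refine ⟨T + 1, |Real.log G|, 2 / δ * Real.log (2 * C / ε), by omega, abs_nonneg _, ?_⟩
  intro Λ hΛ hΛ₀ n m N hdn hnN hNm hAlt hAm hAn hrem
  set S := ∑ k ∈ Finset.Icc 1 N, A k with hS
  set M := N + 2 - d with hM
  set X := L M with hX
  have hX0 : 0 ≤ X := hL0 M
  set s := m - N - 1 with hs
  have hMs : M + s + (d - 1) = m := by omega
  rw [← (hsum M (by omega)).sum_add_tsum_nat_add s, mul_add] at hrem
  have hSle : S ≤ Λ * (c ^ (N + 1) / (c - 1)) := by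
    calc S ≤ ∑ k ∈ Finset.Icc 1 N, Λ * c ^ k := Finset.sum_le_sum fun k hk => by
          rw [Finset.mem_Icc] at hk
          exact hAlt k hk.1 (by omega)
      _ ≤ _ := by
          rw [← Finset.mul_sum]
          gcongr
          exact sum_Icc_pow_le hc N
  have hlate : Real.exp (W * S) * ∑' i, y (M + (i + s)) * Real.exp (-L (M + (i + s))) ≤ ε / 2 := by
    have h1 := htail (M + s) (by omega)
    simp only [add_assoc, add_comm s] at h1
    have h2 : δ * (Λ * c ^ m) ≤ δ * L (s + M) := by
      gcongr
      refine hAm.trans ?_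
      rw [← hMs, add_comm M s]
      exact hAL _
    have h3 : W * S ≤ δ / 2 * (Λ * c ^ m) := by
      calc W * S ≤ W * (Λ * (c ^ (N + 1) / (c - 1))) := by gcongr
        _ = Λ * (W / (c - 1)) * c ^ (N + 1) := by ring
        _ ≤ Λ * (δ / 2 * c ^ T) * c ^ (N + 1) := by gcongr
        _ = δ / 2 * (Λ * c ^ (N + 1 + T)) := by rw [pow_add]; ring
        _ ≤ _ := by
          gcongr
          · exact hc.le
          · omega
    have h4 : Λ ≤ Λ * c ^ m := le_mul_of_one_le_right (by positivity) (one_le_pow₀ hc.le)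
    have h5 : Real.log (2 * C / ε) ≤ δ / 2 * (Λ * c ^ m) := by
      have := mul_le_mul_of_nonneg_left (hΛ₀.trans h4) (by positivity : 0 ≤ δ / 2)
      refine le_trans (le_of_eq ?_) this
      field_simp
    rw [add_comm M s] at h1
    calc _ ≤ Real.exp (W * S) * (C * Real.exp (-(δ * L (s + M)))) := by gcongr
      _ = C * Real.exp (W * S + -(δ * L (s + M))) := by rw [Real.exp_add]; ring
      _ ≤ C * Real.exp (-Real.log (2 * C / ε)) := by
          gcongr
          linarith
      _ = ε / 2 := by
          rw [Real.exp_neg, Real.exp_log (by positivity)]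
          field_simp
  have hearly : ∑ i ∈ Finset.range s, y (M + i) * Real.exp (-L (M + i)) ≤
      Real.exp 1 * p.factorial * (1 + X) ^ p * Real.exp (-X) * (1 + Z) := by
    calc _ ≤ ∑ i ∈ Finset.range s, Real.exp 1 * p.factorial * (1 + X) ^ p * Real.exp (-X) *
            (1 / ((M + i : ℕ) : ℝ) ^ 2) := by
          apply Finset.sum_le_sum
          intro i hi
          rw [Finset.mem_range] at hi
          have hk : (1 : ℝ) ≤ ((M + i : ℕ) : ℝ) := by
            have : 1 ≤ M + i := by omega
            exact_mod_cast this
          have h1 : ((M + i : ℕ) : ℝ) ≤ L (M + i) := by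
            refine le_trans ?_ (hAL (M + i))
            refine le_trans ?_ (hAn (M + i + (d - 1)) (by omega) (by omega))
            exact_mod_cast Nat.le_add_right _ _
          have h2 := pow_mul_exp_neg_le p hX0 (hLmono M (M + i) (by omega) (by omega))
            (by positivity) h1
          rw [mul_one_div, le_div_iff₀ (by positivity)]
          refine le_trans ?_ h2
          rw [hp, pow_add]
          have := hy (M + i) (by omega)
          calc _ ≤ ((M + i : ℕ) : ℝ) ^ q * Real.exp (-L (M + i)) * ((M + i : ℕ) : ℝ) ^ 2 := by
                gcongr
            _ = _ := by ring
      _ ≤ _ := by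
          rw [← Finset.mul_sum]
          gcongr
          have h1 : ∑ i ∈ Finset.range s, 1 / ((M + i : ℕ) : ℝ) ^ 2 =
              ∑ k ∈ Finset.Ico M (M + s), 1 / (k : ℝ) ^ 2 := by
            rw [Finset.sum_Ico_eq_sum_range, Nat.add_sub_cancel_left]
          have h2 := hZs.sum_le_tsum (Finset.Ico M (M + s)) fun i _ => by positivity
          rw [h1]
          linarith
  have hXle : 1 + X ≤ (1 + d * W * c) * (Λ * c ^ N) := by
    have h1 : X ≤ d * W * c * (Λ * c ^ N) := by
      calc X ≤ ∑ j ∈ Finset.range d, W * (Λ * c ^ (N + 1)) := by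
            rw [hX, hL]
            apply Finset.sum_le_sum
            intro j hj
            rw [Finset.mem_range] at hj
            have h2 := hAlt (M + j) (by omega) (by omega)
            have h3 : A (M + j) ≤ Λ * c ^ (N + 1) := by
              refine h2.trans (mul_le_mul_of_nonneg_left ?_ (by positivity))
              exact pow_le_pow_right₀ hc.le (by omega)
            exact mul_le_mul (hW j hj) h3 (hA _) hW0
        _ = _ := by
            simp only [Finset.sum_const, Finset.card_range, nsmul_eq_mul]
            ring
    have h2 : 1 ≤ Λ * c ^ N := one_le_mul_of_one_le_of_one_le hΛ (one_le_pow₀ hc.le)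
    linarith
  have hmain : Real.exp X ≤ Real.exp (W * S) * (G * (Λ * c ^ N) ^ p) := by
    have h1 : ε / 2 ≤ Real.exp (W * S) *
        (Real.exp 1 * p.factorial * ((1 + d * W * c) * (Λ * c ^ N)) ^ p * Real.exp (-X)
          * (1 + Z)) := by
      calc ε / 2 ≤ Real.exp (W * S) * ∑ i ∈ Finset.range s, y (M + i) * Real.exp (-L (M + i)) := by
            linarith
        _ ≤ Real.exp (W * S) *
            (Real.exp 1 * p.factorial * (1 + X) ^ p * Real.exp (-X) * (1 + Z)) := by gcongr
        _ ≤ _ := by gcongr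
    have h2 := mul_le_mul_of_nonneg_left h1 (by positivity : 0 ≤ 2 / ε * Real.exp X)
    have h3 : 2 / ε * Real.exp X * (ε / 2) = Real.exp X := by field_simp
    rw [h3] at h2
    refine h2.trans (le_of_eq ?_)
    rw [hG, mul_pow, Real.exp_neg]
    field_simp
  have hlog := Real.log_le_log (Real.exp_pos X) hmain
  rw [Real.log_exp, Real.log_mul (by positivity) (by positivity), Real.log_exp,
    Real.log_mul (by positivity) (by positivity), Real.log_pow,
    Real.log_mul (x := Λ) (by positivity) (by positivity), Real.log_pow] at hlog
  have := le_abs_self (Real.log G)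
  linarith

theorem exists_remainder_lt {d : ℕ} (hd : 0 < d) {w : ℕ → ℕ} (hw : 1 ≤ w (d - 1))
    {c : ℝ} (hc : 1 < c) {W : ℝ} (hW : ∀ j < d, (w j : ℝ) ≤ W)
    (hroot : (c - 1) * ∑ j ∈ Finset.range d, (w j : ℝ) * c ^ j = W * c ^ (d - 1))
    {A y L : ℕ → ℝ} (hA : ∀ k, 0 ≤ A k) (hmono : ∀ i j, 1 ≤ i → i ≤ j → A i ≤ A j)
    (hL : ∀ k, L k = ∑ j ∈ Finset.range d, w j * A (k + j))
    {q : ℕ} (hy : ∀ k, 1 ≤ k → y k ≤ (k : ℝ) ^ q) {C δ ε : ℝ} (hC : 0 < C) (hδ : 0 < δ)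
    (hε : 0 < ε)
    (hsum : ∀ M, 1 ≤ M → Summable fun i => y (M + i) * Real.exp (-L (M + i)))
    (htail : ∀ M, 1 ≤ M → ∑' i, y (M + i) * Real.exp (-L (M + i)) ≤ C * Real.exp (-(δ * L M)))
    (hunb : ∀ Λ : ℝ, ∃ n, 1 ≤ n ∧ Λ * c ^ n ≤ A n) (N₁ : ℕ) :
    ∃ N, N₁ ≤ N ∧ Real.exp (W * ∑ k ∈ Finset.Icc 1 N, A k) *
        ∑' i, y (N + 2 - d + i) * Real.exp (-L (N + 2 - d + i)) < ε := by
  by_contra! hcon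
  have hc0 : 0 < c := by linarith
  have hW0 : 0 ≤ W := (Nat.cast_nonneg _).trans (hW 0 hd)
  set N₀ := max N₁ d with hN₀
  have hN₀d : d ≤ N₀ := le_max_right _ _
  have hrem := fun N (hN : N₀ ≤ N) => hcon N ((le_max_left _ _).trans hN)
  set S : ℕ → ℝ := fun N => ∑ k ∈ Finset.Icc 1 N, A k with hS
  have hS0 : ∀ N, 0 ≤ S N := fun N => Finset.sum_nonneg fun k _ => hA k
  have hSsucc : ∀ N, S (N + 1) = S N + A (N + 1) := fun N =>
    Finset.sum_Icc_succ_top (by omega) _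
  have hAL : ∀ k, A (k + (d - 1)) ≤ L k := fun k => by
    rw [hL]
    exact le_weighted_sum hd hw hA k
  set K := 2 + W / δ with hK
  have hK2 : 2 ≤ K := by
    have : 0 ≤ W / δ := by positivity
    linarith
  set C₂ := |Real.log (C / ε)| / δ with hC₂
  have hC₂0 : 0 ≤ C₂ := by positivity
  have hstep : ∀ N, N₀ ≤ N → S (N + 1) ≤ K * S N + C₂ := by
    intro N hN
    have h1 : ε ≤ Real.exp (W * S N) * (C * Real.exp (-(δ * L (N + 2 - d)))) :=
      (hrem N hN).trans (by gcongr; exact htail _ (by omega))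
    have h2 : A (N + 1) ≤ L (N + 2 - d) := by
      have := hAL (N + 2 - d)
      rwa [show N + 2 - d + (d - 1) = N + 1 by omega] at this
    have h3 : Real.exp (δ * L (N + 2 - d)) ≤ Real.exp (W * S N) * (C / ε) := by
      rw [Real.exp_neg] at h1
      have h4 := mul_le_mul_of_nonneg_left h1
        (by positivity : 0 ≤ Real.exp (δ * L (N + 2 - d)) / ε)
      field_simp at h4 ⊢
      linarith
    have h5 := Real.log_le_log (Real.exp_pos _) h3
    rw [Real.log_exp, Real.log_mul (by positivity) (by positivity), Real.log_exp] at h5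
    have h6 : δ * A (N + 1) ≤ W * S N + |Real.log (C / ε)| := by
      have := le_abs_self (Real.log (C / ε))
      have := mul_le_mul_of_nonneg_left h2 hδ.le
      linarith
    have h7 : A (N + 1) ≤ W / δ * S N + C₂ := by
      have : A (N + 1) ≤ (W * S N + |Real.log (C / ε)|) / δ := by
        rw [le_div_iff₀ hδ]; linarith
      rw [hC₂]
      refine this.trans (le_of_eq ?_)
      ring
    rw [hSsucc, hK]
    linarith [hS0 N]
  obtain ⟨T, C₁, Λ₀, hT, hC₁, hfine⟩ :=
    exists_critical_recursion_of_remainder_ge hd hw hc hW hA hmono hL hy hC hδ hε hsum htail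
  obtain ⟨B, hB0, hB⟩ := exists_sum_le_of_critical_recursion hd hw hc hW hroot hA hmono
    (hA N₀) hC₁ (Nat.cast_nonneg (q + 2))
  obtain ⟨Λ, hΛ1, hΛ₀, hΛA, hΛbig⟩ : ∃ Λ : ℝ, 1 ≤ Λ ∧ Λ₀ ≤ Λ ∧ A N₀ < Λ ∧
      K ^ T * (B + C₂) * (1 + Real.log Λ) < Λ := by
    have h1 : Tendsto (fun x : ℝ => (1 + Real.log x) / x) atTop (𝓝 0) := by
      have h2 : Tendsto (fun x : ℝ => x⁻¹ + Real.log x / x) atTop (𝓝 (0 + 0)) :=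
        tendsto_inv_atTop_zero.add Real.isLittleO_log_id_atTop.tendsto_div_nhds_zero
      rw [add_zero] at h2
      refine h2.congr fun x => ?_
      rw [add_div, one_div]
    have h3 := (h1.const_mul (K ^ T * (B + C₂))).eventually_lt_const
      (show K ^ T * (B + C₂) * 0 < 1 by simp)
    obtain ⟨Λ, e1, e2, e3, e4⟩ := ((eventually_ge_atTop 1).and ((eventually_ge_atTop Λ₀).and
      ((eventually_gt_atTop (A N₀)).and h3))).exists
    refine ⟨Λ, e1, e2, e3, ?_⟩
    rwa [← mul_div_assoc, div_lt_one (by linarith)] at e4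
  classical
  have hex := hunb Λ
  set m := Nat.find hex with hm
  obtain ⟨hm1, hAm⟩ : 1 ≤ m ∧ Λ * c ^ m ≤ A m := Nat.find_spec hex
  have hAlt : ∀ k, 1 ≤ k → k < m → A k ≤ Λ * c ^ k := fun k hk hkm => by
    have := Nat.find_min hex hkm
    push Not at this
    exact (this hk).le
  have hm0 : N₀ < m := by
    by_contra! h
    have h1 := hmono m N₀ hm1 h
    have h2 : Λ ≤ Λ * c ^ m := le_mul_of_one_le_right (by positivity) (one_le_pow₀ hc.le)
    linarith
  obtain ⟨n, hn0, hnm, hAn, hnk⟩ := exists_last_le (hA N₀) m hm0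
  set P := max n (m - T) with hP
  have hSP : S P ≤ B * (1 + Real.log Λ) * c ^ P := by
    refine hB Λ hΛ1 n P (by omega) (le_max_left _ _) hAn fun N hnN hNP => ?_
    rw [← hL]
    exact hfine Λ hΛ1 hΛ₀ n m N (by omega) hnN (by omega) hAlt hAm hnk (hrem N (by omega))
  have hgrow := add_le_pow_mul_of_step hK2 hC₂0 (P := P)
    (fun N hN => hstep N (by omega)) (m - P)
  rw [show P + (m - P) = m by omega] at hgrow
  have hSm : A m ≤ S m := by
    obtain ⟨m', hm'⟩ : ∃ m', m = m' + 1 := ⟨m - 1, by omega⟩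
    rw [hm', hSsucc]
    linarith [hS0 m']
  have hl : 0 ≤ Real.log Λ := Real.log_nonneg hΛ1
  have hfinal : Λ * c ^ m ≤ K ^ T * (B + C₂) * (1 + Real.log Λ) * c ^ m := by
    calc Λ * c ^ m ≤ K ^ (m - P) * (S P + C₂) := by linarith
      _ ≤ K ^ T * (B * (1 + Real.log Λ) * c ^ m + C₂ * ((1 + Real.log Λ) * c ^ m)) := by
          have hPm : c ^ P ≤ c ^ m := pow_le_pow_right₀ hc.le (by omega)
          have hKK : K ^ (m - P) ≤ K ^ T := pow_le_pow_right₀ (by linarith) (by omega)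
          have h1 : S P ≤ B * (1 + Real.log Λ) * c ^ m := hSP.trans (by gcongr)
          have h2 : C₂ ≤ C₂ * ((1 + Real.log Λ) * c ^ m) :=
            le_mul_of_one_le_right hC₂0
              (one_le_mul_of_one_le_of_one_le (by linarith) (one_le_pow₀ hc.le))
          have := hS0 P
          gcongr
      _ = _ := by ring
  have := le_of_mul_le_mul_right hfinal (by positivity)
  linarith

/-- A polynomial lower bound on `exp (L k)` makes the remainders decay like a power of
their first term. -/
theorem exists_tail_le {y L : ℕ → ℝ} {η τ : ℝ} (hη : 0 < η) (hητ : η < τ)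
    (hy0 : ∀ k, 0 ≤ y k) (hy : ∀ k : ℕ, 1 ≤ k → y k ≤ (k : ℝ) ^ η)
    (hmono : ∀ i j, 1 ≤ i → i ≤ j → L i ≤ L j)
    (hL : ∀ k : ℕ, 1 ≤ k → (1 + τ) * Real.log k ≤ L k) :
    ∃ C δ : ℝ, 0 < C ∧ 0 < δ ∧ ∀ M, 1 ≤ M →
      (Summable fun i => y (M + i) * Real.exp (-L (M + i))) ∧
      ∑' i, y (M + i) * Real.exp (-L (M + i)) ≤ C * Real.exp (-(δ * L M)) := by
  set κ := (τ - η) / 2 with hκ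
  have hκ0 : 0 < κ := by rw [hκ]; linarith
  have hτ : 0 < 1 + τ := by linarith
  set δ := κ / (1 + τ) with hδ
  have hδ0 : 0 < δ := by positivity
  have hδ1 : δ ≤ 1 := by
    rw [hδ, div_le_one hτ, hκ]
    linarith
  have hδτ : δ * (1 + τ) = κ := div_mul_cancel₀ _ hτ.ne'
  have hs : Summable fun k : ℕ => (k : ℝ) ^ (-(1 + κ)) :=
    Real.summable_nat_rpow.2 (by linarith)
  have hterm : ∀ M, 1 ≤ M → ∀ i, y (M + i) * Real.exp (-L (M + i)) ≤
      Real.exp (-(δ * L M)) * ((i + M : ℕ) : ℝ) ^ (-(1 + κ)) := by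
    intro M hM i
    rw [add_comm i M]
    have hk : 1 ≤ M + i := by omega
    have hk' : (1 : ℝ) ≤ ((M + i : ℕ) : ℝ) := by exact_mod_cast hk
    have h1 := hL (M + i) hk
    have h2 := hmono M (M + i) hM (by omega)
    set l := Real.log ((M + i : ℕ) : ℝ) with hl
    have hl0 : 0 ≤ l := Real.log_nonneg hk'
    calc _ ≤ ((M + i : ℕ) : ℝ) ^ η * Real.exp (-L (M + i)) := by
          gcongr
          exact hy _ hk
      _ = Real.exp (l * η + -L (M + i)) := by
          rw [Real.rpow_def_of_pos (by linarith), Real.exp_add]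
      _ ≤ Real.exp (-(δ * L M) + l * (-(1 + κ))) := by
          rw [Real.exp_le_exp]
          have h3 := mul_le_mul_of_nonneg_left h2 hδ0.le
          have h4 := mul_le_mul_of_nonneg_left h1 (sub_nonneg.2 hδ1)
          have h5 : (1 - δ) * ((1 + τ) * l) = (1 + κ + η) * l := by
            linear_combination (-l) * hδτ - 2 * l * hκ
          linarith
      _ = _ := by rw [Real.exp_add, Real.rpow_def_of_pos (by linarith)]
  refine ⟨1 + ∑' k : ℕ, (k : ℝ) ^ (-(1 + κ)), δ, ?_, hδ0, fun M hM => ?_⟩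
  · have : 0 ≤ ∑' k : ℕ, (k : ℝ) ^ (-(1 + κ)) := tsum_nonneg fun k => by positivity
    linarith
  have hsM := ((summable_nat_add_iff M).2 hs).mul_left (Real.exp (-(δ * L M)))
  have hsum := Summable.of_nonneg_of_le
    (fun i => mul_nonneg (hy0 (M + i)) (Real.exp_pos _).le) (hterm M hM) hsM
  refine ⟨hsum, (hsum.tsum_le_tsum (hterm M hM) hsM).trans ?_⟩
  rw [tsum_mul_left, mul_comm]
  gcongr
  have h1 := hs.sum_add_tsum_nat_add M
  have h2 : 0 ≤ ∑ k ∈ Finset.range M, (k : ℝ) ^ (-(1 + κ)) :=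
    Finset.sum_nonneg fun k _ => by positivity
  linarith

theorem liminf_eq_zero_of_frequently_lt {u : ℕ → ℝ} (h0 : ∀ n, 0 ≤ u n)
    (h : ∀ ε > 0, ∀ N, ∃ n, N ≤ n ∧ u n < ε) : liminf u atTop = 0 := by
  have : {x | ∀ᶠ n in atTop, x ≤ u n} = Set.Iic 0 := by
    ext x
    refine ⟨fun hx => ?_, fun hx => Eventually.of_forall fun n => le_trans hx (h0 n)⟩
    by_contra hx0
    obtain ⟨N, hN⟩ := eventually_atTop.1 hx
    obtain ⟨n, hn, hlt⟩ := h x (not_le.1 hx0) N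
    exact (hN n hn).not_gt hlt
  rw [liminf_eq, this, csSup_Iic]

theorem exists_mul_pow_le_log {a : ℕ → ℕ} (ha_pos : ∀ n, 1 ≤ n → 0 < a n) {c : ℝ} (hc : 0 < c)
    (hlimsup : limsup (fun n : ℕ => (((a n : ℝ) ^ (1 / c ^ n) : ℝ) : EReal)) atTop = ⊤) (Λ : ℝ) :
    ∃ n, 1 ≤ n ∧ Λ * c ^ n ≤ Real.log (a n) := by
  have h1 : ((Real.exp Λ : ℝ) : EReal) <
      limsup (fun n : ℕ => (((a n : ℝ) ^ (1 / c ^ n) : ℝ) : EReal)) atTop := by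
    rw [hlimsup]
    exact EReal.coe_lt_top _
  obtain ⟨n, h2, hn⟩ := ((frequently_lt_of_lt_limsup (by isBoundedDefault) h1).and_eventually
    (eventually_ge_atTop 1)).exists
  refine ⟨n, hn, ?_⟩
  have hpos : (0 : ℝ) < a n := by exact_mod_cast ha_pos n hn
  rw [EReal.coe_lt_coe_iff, Real.rpow_def_of_pos hpos, Real.exp_lt_exp, mul_one_div,
    lt_div_iff₀ (by positivity)] at h2
  exact h2.le

/-- **key proposition.** Under the hypotheses of the generalized theorem
(`d ≥ 1`, tuple `w` with `w (d-1) ≥ 1`, `W = max {w 0, …, w (d-1)}`, `c` the unique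
positive root of `P_w`, `a`, `b` positive integer sequences with `a` non-decreasing,
`b_n ≤ n^η`, `a_n^{w_0}⋯a_{n+d-1}^{w_{d-1}} ≥ n^(1+τ)` for some `0 < η < τ`, and
`limsup_n a_n^(1/c^n) = ∞`), setting `x_n = a_{n-d+1}^{w_0}⋯a_n^{w_{d-1}}` and
`y_n = b_{n-d+1}` for `n ≥ d`, `D_N = ∏_{k=1}^N a_k^W`, and
`r_N = ∑_{n ≥ max(N+1,d)} y_n/x_n`, we have `liminf_N D_N · r_N = 0`. -/
theorem stmt_11 (d : ℕ) (hd : 0 < d) (w : ℕ → ℕ) (hw : 1 ≤ w (d - 1))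
    (c : ℝ) (hc : 0 < c)
    (hroot : (c - 1) * ∑ j ∈ Finset.range d, (w j : ℝ) * c ^ j
        - (((Finset.range d).sup w : ℕ) : ℝ) * c ^ (d - 1) = 0)
    (a b : ℕ → ℕ)
    (ha_pos : ∀ n, 1 ≤ n → 0 < a n) (hb_pos : ∀ n, 1 ≤ n → 0 < b n)
    (ha_mono : ∀ n, 1 ≤ n → a n ≤ a (n + 1))
    (η τ : ℝ) (hη : 0 < η) (hητ : η < τ)
    (hb : ∀ n : ℕ, 1 ≤ n → (b n : ℝ) ≤ (n : ℝ) ^ η)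
    (ha : ∀ n : ℕ, 1 ≤ n → (n : ℝ) ^ (1 + τ) ≤ ∏ j ∈ Finset.range d, (a (n + j) : ℝ) ^ w j)
    (hlimsup : limsup (fun n : ℕ => (((a n : ℝ) ^ (1 / c ^ n) : ℝ) : EReal)) atTop = ⊤)
    (D : ℕ → ℝ)
    (hD : ∀ N, D N = ∏ k ∈ Finset.Icc 1 N, (a k : ℝ) ^ ((Finset.range d).sup w))
    (r : ℕ → ℝ)
    (hr : ∀ N, r N = ∑' n : ℕ,
      (b (max (N + 1) d + n - d + 1) : ℝ) /
        ∏ j ∈ Finset.range d, (a (max (N + 1) d + n - d + 1 + j) : ℝ) ^ w j) :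
    liminf (fun N : ℕ => D N * r N) atTop = 0 := by
  have hc1 : 1 < c := one_lt_of_root hd hw hc hroot
  set W := (Finset.range d).sup w with hW
  let A : ℕ → ℝ := fun k => Real.log (a k)
  let L : ℕ → ℝ := fun k => ∑ j ∈ Finset.range d, w j * A (k + j)
  have hA : ∀ k, 0 ≤ A k := fun k => Real.log_natCast_nonneg _
  have ha_mono' : ∀ i j, 1 ≤ i → i ≤ j → a i ≤ a j := fun i j hi hij => by
    induction j, hij using Nat.le_induction with
    | base => exact le_rfl
    | succ j hj ih => exact ih.trans (ha_mono j (hi.trans hj))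
  have hmono : ∀ i j, 1 ≤ i → i ≤ j → A i ≤ A j := fun i j hi hij =>
    Real.log_le_log (by exact_mod_cast ha_pos i hi) (by exact_mod_cast ha_mono' i j hi hij)
  have hLmono : ∀ i j, 1 ≤ i → i ≤ j → L i ≤ L j := fun i j hi hij =>
    Finset.sum_le_sum fun l _ =>
      mul_le_mul_of_nonneg_left (hmono _ _ (by omega) (by omega)) (Nat.cast_nonneg _)
  have hexp : ∀ k, 1 ≤ k → ∀ e : ℕ, (a k : ℝ) ^ e = Real.exp (e * A k) := fun k hk e => by
    rw [Real.exp_nat_mul, Real.exp_log (by exact_mod_cast ha_pos k hk)]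
  have hx : ∀ k, 1 ≤ k → ∏ j ∈ Finset.range d, (a (k + j) : ℝ) ^ w j = Real.exp (L k) :=
    fun k hk => by
      rw [Real.exp_sum]
      exact Finset.prod_congr rfl fun j _ => hexp _ (by omega) _
  have hDexp : ∀ N, D N = Real.exp (W * ∑ k ∈ Finset.Icc 1 N, A k) := fun N => by
    rw [hD, Finset.mul_sum, Real.exp_sum]
    exact Finset.prod_congr rfl fun k hk => hexp k (Finset.mem_Icc.1 hk).1 _
  have hrexp : ∀ N, d ≤ N →
      r N = ∑' i, (b (N + 2 - d + i) : ℝ) * Real.exp (-L (N + 2 - d + i)) := fun N hN => by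
    rw [hr]
    refine tsum_congr fun i => ?_
    rw [show max (N + 1) d + i - d + 1 = N + 2 - d + i by omega, hx _ (by omega),
      Real.exp_neg, div_eq_mul_inv]
  have hlogL : ∀ k : ℕ, 1 ≤ k → (1 + τ) * Real.log k ≤ L k := fun k hk => by
    have hk0 : (0 : ℝ) < k := by exact_mod_cast hk
    have h := ha k hk
    rw [hx k hk, Real.rpow_def_of_pos hk0, Real.exp_le_exp] at h
    linarith
  obtain ⟨C, δ, hC, hδ, htail⟩ := exists_tail_le (y := fun k => (b k : ℝ)) hη hητ
    (fun k => Nat.cast_nonneg _) hb hLmono hlogL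
  have hy : ∀ k : ℕ, 1 ≤ k → (b k : ℝ) ≤ (k : ℝ) ^ ⌈η⌉₊ := fun k hk => by
    refine (hb k hk).trans ?_
    rw [← Real.rpow_natCast]
    exact Real.rpow_le_rpow_of_exponent_le (by exact_mod_cast hk) (Nat.le_ceil η)
  refine liminf_eq_zero_of_frequently_lt (fun N => ?_) fun ε hε N₁ => ?_
  · rw [hDexp, hr]
    exact mul_nonneg (Real.exp_pos _).le (tsum_nonneg fun i => by positivity)
  · obtain ⟨N, hN, hlt⟩ := exists_remainder_lt (W := W) hd hw hc1
      (fun j hj => by exact_mod_cast Finset.le_sup (f := w) (Finset.mem_range.2 hj))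
      (sub_eq_zero.1 hroot) hA hmono (L := L) (fun k => rfl) (y := fun k => (b k : ℝ)) hy hC hδ hε
      (fun M hM => (htail M hM).1) (fun M hM => (htail M hM).2)
      (exists_mul_pow_le_log ha_pos hc hlimsup) (max N₁ d)
    refine ⟨N, (le_max_left _ _).trans hN, ?_⟩
    rw [hDexp, hrexp N ((le_max_right _ _).trans hN)]
    exact hlt
end

section
/- Fix a positive integer d and a tuple of non-negative integers w = (w_0, …, w_{d-1}) with w_{d-1} ≥ 1, and for a sequence of positive integers {a_n}_{n=1}^∞ write S({a_n}) = ∑_{n=1}^∞ 1/(a_n^{w_0} a_{n+1}^{w_1} ⋯ a_{n+d-1}^{w_{d-1}}). Let {β_n}_{n=1}^∞ and {γ_n}_{n=1}^∞ be monotonically increasing sequences of positive integers with β_n ≤ γ_n for every n, such that: (i) ∑_{n=1}^∞ 1/(β_n^{w_0} β_{n+1}^{w_1} ⋯ β_{n+d-1}^{w_{d-1}}) < ∞; (ii) lim_{n→∞} β_n/γ_n = 0; and (iii) lim_{n→∞} (β_n/γ_{n+1})^{w_0} ⋯ (β_{n+d-2}/γ_{n+d-1})^{w_{d-2}} · (β_{n+d-1}/β_{n+d})^{w_{d-1}}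 · β_{n+d-1} = ∞. Then the set { S({a_n}) : a_n ∈ [β_n, γ_n] ∩ ℕ for every n ∈ ℕ } is equal to a finite union of non-degenerate closed bounded intervals, i.e., there exist finitely many pairs of reals u_i < v_i such that the set equals the union of the intervals [u_i, v_i]. -/
open Filter Topology

namespace WindowSum

/-- The product `a_{n+1}^{w_0} ⋯ a_{n+d}^{w_{d-1}}`. -/
def den (d : ℕ) (w a : ℕ → ℕ) (n : ℕ) : ℕ :=
  ∏ j ∈ Finset.range d, a (n + 1 + j) ^ w j

/-- The sum of the reciprocals of `den d w a`. -/
noncomputable def total (d : ℕ) (w a : ℕ → ℕ) : ℝ :=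
  ∑' n : ℕ, 1 / (den d w a n : ℝ)

/-- The sequence that follows `a` before `N` and `b` from `N` on. -/
def splice (N : ℕ) (a b : ℕ → ℕ) (n : ℕ) : ℕ :=
  if n < N then a n else b n

/-- Sequences lying between `β` and `γ` at every positive index. -/
def Between (β γ a : ℕ → ℕ) : Prop :=
  ∀ n, 1 ≤ n → β n ≤ a n ∧ a n ≤ γ n

lemma den_pos {d : ℕ} {w a : ℕ → ℕ} (ha : ∀ n, 1 ≤ n → 0 < a n) (n : ℕ) : 0 < den d w a n :=
  Finset.prod_pos fun _ _ => pow_pos (ha _ (by omega)) _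

lemma den_mono {d : ℕ} {w a b : ℕ → ℕ} {n : ℕ} (h : ∀ i, n + 1 ≤ i → a i ≤ b i) :
    den d w a n ≤ den d w b n :=
  Finset.prod_le_prod' fun _ _ => Nat.pow_le_pow_left (h _ (by omega)) _

lemma den_congr {d : ℕ} {w a b : ℕ → ℕ} {n : ℕ} (h : ∀ i, i ≤ n + d → a i = b i) :
    den d w a n = den d w b n :=
  Finset.prod_congr rfl fun j hj => by
    rw [Finset.mem_range] at hj
    rw [h _ (by omega)]

lemma den_succ (e : ℕ) (w a : ℕ → ℕ) (n : ℕ) :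
    den (e + 1) w a n = den e w a n * a (n + 1 + e) ^ w e :=
  Finset.prod_range_succ _ _

lemma one_div_den_le {d : ℕ} {w a b : ℕ → ℕ} {n : ℕ} (ha : ∀ n, 1 ≤ n → 0 < a n)
    (h : ∀ i, n + 1 ≤ i → a i ≤ b i) : 1 / (den d w b n : ℝ) ≤ 1 / (den d w a n : ℝ) :=
  one_div_le_one_div_of_le (by exact_mod_cast den_pos ha n) (by exact_mod_cast den_mono h)

section Sums

variable {d : ℕ} {w β γ : ℕ → ℕ}

lemma Between.pos {a : ℕ → ℕ} (ha : Between β γ a) (hβ : ∀ n, 1 ≤ n → 0 < β n) :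
    ∀ n, 1 ≤ n → 0 < a n := fun n hn => (hβ n hn).trans_le (ha n hn).1

lemma Between.splice {a b : ℕ → ℕ} (ha : Between β γ a) (hb : Between β γ b) (N : ℕ) :
    Between β γ (splice N a b) := fun n hn => by
  unfold WindowSum.splice
  split_ifs
  exacts [ha n hn, hb n hn]

lemma Between.update {a : ℕ → ℕ} (ha : Between β γ a) {N c : ℕ} (h₁ : β N ≤ c) (h₂ : c ≤ γ N) :
    Between β γ (Function.update a N c) := fun n hn => by
  rcases eq_or_ne n N with rfl | h
  · simp [h₁, h₂]
  · simpa [h] using ha n hn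

lemma Between.summable {a : ℕ → ℕ} (ha : Between β γ a) (hβ : ∀ n, 1 ≤ n → 0 < β n)
    (hsum : Summable fun n => 1 / (den d w β n : ℝ)) :
    Summable fun n => 1 / (den d w a n : ℝ) :=
  hsum.of_nonneg_of_le (fun _ => by positivity)
    fun _ => one_div_den_le hβ fun i hi => (ha i (by omega)).1

lemma total_anti {a b : ℕ → ℕ} (ha : Between β γ a) (hb : Between β γ b)
    (hβ : ∀ n, 1 ≤ n → 0 < β n) (hsum : Summable fun n => 1 / (den d w β n : ℝ))
    (h : ∀ n, 1 ≤ n → a n ≤ b n) : total d w b ≤ total d w a :=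
  (hb.summable hβ hsum).tsum_le_tsum
    (fun _ => one_div_den_le (ha.pos hβ) fun i hi => h i (by omega)) (ha.summable hβ hsum)

lemma tendsto_total_splice {a b : ℕ → ℕ} (ha : Between β γ a) (hb : Between β γ b)
    (hβ : ∀ n, 1 ≤ n → 0 < β n) (hsum : Summable fun n => 1 / (den d w β n : ℝ)) :
    Tendsto (fun N => total d w (splice N a b)) atTop (𝓝 (total d w a)) := by
  refine tendsto_tsum_of_dominated_convergence hsum (fun n => ?_) (Eventually.of_forall fun N n => ?_)
  · refine tendsto_const_nhds.congr' ?_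
    filter_upwards [eventually_gt_atTop (n + d)] with N hN
    rw [den_congr fun i hi => ?_]
    simp [splice, hi.trans_lt hN]
  · rw [Real.norm_of_nonneg (by positivity)]
    exact one_div_den_le hβ fun i hi => (ha.splice hb N i (by omega)).1

lemma total_splice_lt (hw : 1 ≤ w (d - 1)) (hd : 0 < d) (hβ : ∀ n, 1 ≤ n → 0 < β n)
    (hβγ : ∀ n, 1 ≤ n → β n ≤ γ n) (hsum : Summable fun n => 1 / (den d w β n : ℝ))
    {a : ℕ → ℕ} (ha : Between β γ a) {N : ℕ} (hlt : ∀ n, N ≤ n → β n < γ n) :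
    total d w (splice N a γ) < total d w (splice N a β) := by
  have hb : Between β γ β := fun n hn => ⟨le_rfl, hβγ n hn⟩
  have hg : Between β γ γ := fun n hn => ⟨hβγ n hn, le_rfl⟩
  have hle : ∀ i, 1 ≤ i → splice N a β i ≤ splice N a γ i := fun i hi => by
    unfold splice
    split_ifs
    exacts [le_rfl, hβγ i hi]
  have hpos := (ha.splice hb N).pos hβ
  refine Summable.tsum_lt_tsum (i := N) (fun n => one_div_den_le hpos fun i hi => hle i (by omega))
    ?_ ((ha.splice hg N).summable hβ hsum) ((ha.splice hb N).summable hβ hsum)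
  refine one_div_lt_one_div_of_lt (by exact_mod_cast den_pos hpos N) ?_
  have : den d w (splice N a β) N < den d w (splice N a γ) N := by
    refine Finset.prod_lt_prod (fun i _ => pow_pos (hpos _ (by omega)) _)
      (fun i _ => Nat.pow_le_pow_left (hle _ (by omega)) _)
      ⟨d - 1, by simp [hd], Nat.pow_lt_pow_left ?_ (by omega)⟩
    have h := hlt (N + 1 + (d - 1)) (by omega)
    simpa [splice, show ¬ (N + 1 + (d - 1) < N) by omega] using h
  exact_mod_cast this

end Sums

section Intervals

variable {β γ : ℕ → ℕ} {S : (ℕ → ℕ) → ℝ} {N₀ : ℕ}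

lemma splice_succ_update_self (N : ℕ) (a b : ℕ → ℕ) :
    splice (N + 1) (Function.update a N (b N)) b = splice N a b := by
  funext n
  rcases lt_trichotomy n N with h | rfl | h
  · simp [splice, h, h.ne, Nat.lt_succ_of_lt h]
  · simp [splice]
  · simp [splice, show ¬ n < N by omega, show ¬ n < N + 1 by omega]

/-- One step of the greedy expansion: if consecutive intervals overlap, a point of the interval
attached to a prefix of length `N` lies in the interval of one of its extensions. -/
lemma exists_digit {N : ℕ} (hβγ : β N ≤ γ N) {a : ℕ → ℕ}
    (hoverlap : ∀ c, β N ≤ c → c < γ N → S (splice (N + 1) (Function.update a N c) γ) ≤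
      S (splice (N + 1) (Function.update a N (c + 1)) β))
    {x : ℝ} (h₁ : S (splice N a γ) ≤ x) (h₂ : x ≤ S (splice N a β)) :
    ∃ c, β N ≤ c ∧ c ≤ γ N ∧ S (splice (N + 1) (Function.update a N c) γ) ≤ x ∧
      x ≤ S (splice (N + 1) (Function.update a N c) β) := by
  classical
  have hex : ∃ c, β N ≤ c ∧ S (splice (N + 1) (Function.update a N c) γ) ≤ x :=
    ⟨γ N, hβγ, by rwa [splice_succ_update_self]⟩
  obtain ⟨hc₁, hc₂⟩ := Nat.find_spec hex
  have hcγ : Nat.find hex ≤ γ N := Nat.find_min' hex ⟨hβγ, by rwa [splice_succ_update_self]⟩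
  refine ⟨Nat.find hex, hc₁, hcγ, hc₂, ?_⟩
  rcases hc₁.eq_or_lt with h | h
  · rwa [← h, splice_succ_update_self]
  · obtain ⟨c, hc⟩ : ∃ c, Nat.find hex = c + 1 := ⟨Nat.find hex - 1, by omega⟩
    have hmin := Nat.find_min hex (m := c) (by omega)
    rw [hc]
    have hβc : β N ≤ c := by omega
    have : x < S (splice (N + 1) (Function.update a N c) γ) := by
      by_contra! hx
      exact hmin ⟨hβc, hx⟩
    exact this.le.trans (hoverlap c hβc (by omega))

/-- If consecutive intervals overlap from `N₀` on, every point of the interval attached to a prefix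
of length `N₀` is a value of `S`. -/
lemma exists_between_eq (hN₀ : 1 ≤ N₀) (hβγ : ∀ n, 1 ≤ n → β n ≤ γ n)
    (hoverlap : ∀ N, N₀ ≤ N → ∀ a, Between β γ a → a N < γ N →
      S (splice (N + 1) a γ) ≤ S (splice (N + 1) (Function.update a N (a N + 1)) β))
    (hlim : ∀ a b, Between β γ a → Between β γ b →
      Tendsto (fun N => S (splice N a b)) atTop (𝓝 (S a)))
    {a : ℕ → ℕ} (ha : Between β γ a) {x : ℝ}
    (h₁ : S (splice N₀ a γ) ≤ x) (h₂ : x ≤ S (splice N₀ a β)) :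
    ∃ b, Between β γ b ∧ S b = x := by
  have step : ∀ N, N₀ ≤ N → ∀ a, (Between β γ a ∧ S (splice N a γ) ≤ x ∧ x ≤ S (splice N a β)) →
      ∃ a', (Between β γ a' ∧ S (splice (N + 1) a' γ) ≤ x ∧ x ≤ S (splice (N + 1) a' β)) ∧
        ∀ n, n < N → a' n = a n := by
    rintro N hN a ⟨ha, hx₁, hx₂⟩
    obtain ⟨c, hc₁, hc₂, hc₃, hc₄⟩ := exists_digit (hβγ N (by omega)) (a := a) (fun c hc hc' => by
      simpa using hoverlap N hN _ (ha.update hc hc'.le) (by simpa using hc')) hx₁ hx₂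
    exact ⟨_, ⟨ha.update hc₁ hc₂, hc₃, hc₄⟩, fun n hn => by simp [hn.ne]⟩
  choose! F hF hFa using step
  let A : ℕ → ℕ → ℕ := fun k => Nat.rec a (fun k a => F (N₀ + k) a) k
  have hA : ∀ k, Between β γ (A k) ∧ S (splice (N₀ + k) (A k) γ) ≤ x ∧
      x ≤ S (splice (N₀ + k) (A k) β) := fun k => by
    induction k with
    | zero => exact ⟨ha, h₁, h₂⟩
    | succ k ih => exact hF (N₀ + k) (by omega) _ ih
  have hstab : ∀ n k m, n < N₀ + k → A (k + m) n = A k n := fun n k m hn => by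
    induction m with
    | zero => rfl
    | succ m ih => rw [← ih]; exact hFa (N₀ + (k + m)) (by omega) _ (hA _) n (by omega)
  let b : ℕ → ℕ := fun n => A (n + 1) n
  have hb : Between β γ b := fun n hn => (hA (n + 1)).1 n hn
  have hsplice : ∀ k g, splice (N₀ + k) b g = splice (N₀ + k) (A k) g := fun k g => by
    funext n
    unfold splice
    split_ifs with h
    · show A (n + 1) n = A k n
      rcases le_total (n + 1) k with hk | hk
      · obtain ⟨m, rfl⟩ := Nat.exists_eq_add_of_le hk
        exact (hstab n (n + 1) m (by omega)).symm
      · obtain ⟨m, hm⟩ := Nat.exists_eq_add_of_le hk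
        rw [hm]
        exact hstab n k m h
    · rfl
  have shift : ∀ g, Between β γ g → Tendsto (fun k => S (splice (N₀ + k) b g)) atTop (𝓝 (S b)) :=
    fun g hg => (hlim b g hb hg).comp (tendsto_atTop_mono (fun k => Nat.le_add_left k N₀) tendsto_id)
  refine ⟨b, hb, le_antisymm ?_ ?_⟩
  · exact le_of_tendsto' (shift γ fun n hn => ⟨hβγ n hn, le_rfl⟩) fun k => by
      rw [hsplice]
      exact (hA k).2.1
  · exact ge_of_tendsto' (shift β fun n hn => ⟨le_rfl, hβγ n hn⟩) fun k => by
      rw [hsplice]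
      exact (hA k).2.2

end Intervals

section Overlap

variable {e : ℕ} {w β γ : ℕ → ℕ}

/-- If `Y ≤ 2 X` on a window and `Y` is much smaller than `X` at its last index, then the window
product of `Y` is at most half of that of `X`. -/
lemma two_mul_den_le (hw : 1 ≤ w e) {X Y : ℕ → ℕ} {n : ℕ} (h : ∀ i, n + 1 ≤ i → Y i ≤ 2 * X i)
    (hlast : 2 ^ (∑ j ∈ Finset.range e, w j + 1) * Y (n + 1 + e) ≤ X (n + 1 + e)) :
    2 * den (e + 1) w Y n ≤ den (e + 1) w X n := by
  have h₁ : den e w Y n ≤ 2 ^ (∑ j ∈ Finset.range e, w j) * den e w X n := by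
    unfold den
    rw [← Finset.prod_pow_eq_pow_sum, ← Finset.prod_mul_distrib]
    refine Finset.prod_le_prod' fun j _ => ?_
    rw [← mul_pow]
    exact Nat.pow_le_pow_left (h _ (by omega)) _
  have h₂ : 2 ^ (∑ j ∈ Finset.range e, w j + 1) * Y (n + 1 + e) ^ w e ≤ X (n + 1 + e) ^ w e :=
    calc _ ≤ (2 ^ (∑ j ∈ Finset.range e, w j + 1)) ^ w e * Y (n + 1 + e) ^ w e :=
          Nat.mul_le_mul_right _ (Nat.le_self_pow (by omega) _)
      _ = (2 ^ (∑ j ∈ Finset.range e, w j + 1) * Y (n + 1 + e)) ^ w e := (mul_pow _ _ _).symm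
      _ ≤ _ := Nat.pow_le_pow_left hlast _
  rw [den_succ, den_succ]
  calc 2 * (den e w Y n * Y (n + 1 + e) ^ w e)
      ≤ 2 * (2 ^ (∑ j ∈ Finset.range e, w j) * den e w X n * Y (n + 1 + e) ^ w e) := by gcongr
    _ = den e w X n * (2 ^ (∑ j ∈ Finset.range e, w j + 1) * Y (n + 1 + e) ^ w e) := by ring
    _ ≤ _ := Nat.mul_le_mul_left _ h₂

lemma one_div_pow_sub_le {c : ℝ} (hc : 0 < c) (m : ℕ) :
    1 / c ^ m - 1 / (c + 1) ^ m ≤ m / (c ^ m * c) := by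
  have h := one_add_mul_le_pow (a := -(1 / (c + 1))) (by
    have : 1 / (c + 1) ≤ 1 := by rw [div_le_one (by positivity)]; linarith
    linarith) m
  have h1 : (1 + -(1 / (c + 1))) = c / (c + 1) := by field_simp; ring
  rw [h1, div_pow] at h
  have h2 : (m : ℝ) * (1 / (c + 1)) ≤ m / c := by
    rw [mul_one_div]
    gcongr
    linarith
  have h3 : 1 - m / c ≤ c ^ m / (c + 1) ^ m := by linarith
  calc 1 / c ^ m - 1 / (c + 1) ^ m = (1 - c ^ m / (c + 1) ^ m) / c ^ m := by field_simp
    _ ≤ (m / c) / c ^ m := by gcongr; linarith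
    _ = _ := by field_simp

set_option maxHeartbeats 800000 in
/-- The overlap inequality at the index `n + e + 1`. -/
lemma total_splice_overlap (hw : 1 ≤ w e) (hβ : ∀ n, 1 ≤ n → 0 < β n)
    (hβγ : ∀ n, 1 ≤ n → β n ≤ γ n)
    (hsum : Summable fun n => 1 / (den (e + 1) w β n : ℝ)) {n : ℕ}
    (hratio : ∀ i, n ≤ i → 2 ^ (∑ j ∈ Finset.range e, w j + 1) * β i ≤ γ i)
    (hcond : 2 * w e * (den e w γ (n + 1) * β (n + e + 2) ^ w e) ≤
      den e w β n * β (n + e + 1) ^ w e * β (n + e + 1))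
    {a : ℕ → ℕ} (ha : Between β γ a) (hlt : a (n + e + 1) < γ (n + e + 1)) :
    total (e + 1) w (splice (n + e + 2) a γ) ≤
      total (e + 1) w
        (splice (n + e + 2) (Function.update a (n + e + 1) (a (n + e + 1) + 1)) β) := by
  set c := a (n + e + 1) with hc
  set X := splice (n + e + 2) a γ with hX
  set Y := splice (n + e + 2) (Function.update a (n + e + 1) (c + 1)) β with hY
  have hβc : β (n + e + 1) ≤ c := (ha _ (by omega)).1
  have hXb : Between β γ X := ha.splice (fun n hn => ⟨hβγ n hn, le_rfl⟩) _
  have hYb : Between β γ Y :=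
    (ha.update (by omega) hlt).splice (fun n hn => ⟨le_rfl, hβγ n hn⟩) _
  have hcpos : 0 < c := ha.pos hβ _ (by omega)
  have hYX_lt : ∀ i, i < n + e + 1 → Y i = X i := fun i hi => by
    simp [hX, hY, splice, hi.ne, show i < n + e + 2 by omega]
  have hX_lt : ∀ i, i < n + e + 2 → X i = a i := fun i hi => by simp [hX, splice, hi]
  have hX_eq : X (n + e + 1) = c := by simp [hX, splice, hc]
  have hY_eq : Y (n + e + 1) = c + 1 := by simp [hY, splice]
  have hX_gt : ∀ i, n + e + 2 ≤ i → X i = γ i := fun i hi => by simp [hX, splice, hi.not_gt]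
  have hY_gt : ∀ i, n + e + 2 ≤ i → Y i = β i := fun i hi => by simp [hY, splice, hi.not_gt]
  have hYX : ∀ i, 1 ≤ i → Y i ≤ 2 * X i := fun i hi => by
    rcases lt_trichotomy i (n + e + 1) with h | rfl | h
    · rw [hYX_lt i h]; omega
    · rw [hX_eq, hY_eq]; omega
    · rw [hX_gt i h, hY_gt i h]
      have := hβγ i hi
      omega
  have hhalf : ∀ k, n + 1 ≤ k → 2 * den (e + 1) w Y k ≤ den (e + 1) w X k := fun k hk =>
    two_mul_den_le hw (fun i hi => hYX i (by omega)) (by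
      rw [hX_gt _ (by omega), hY_gt _ (by omega)]
      exact hratio _ (by omega))
  have hYpos : ∀ k, (0 : ℝ) < den (e + 1) w Y k := fun k => by
    exact_mod_cast den_pos (hYb.pos hβ) k
  have hhalf' : ∀ k, n + 1 ≤ k →
      1 / (den (e + 1) w X k : ℝ) ≤ 1 / (2 * (den (e + 1) w Y k : ℝ)) := fun k hk =>
    one_div_le_one_div_of_le (by have := hYpos k; positivity) (by exact_mod_cast hhalf k hk)
  have hle : ∀ k, n + 1 ≤ k →
      1 / (den (e + 1) w X k : ℝ) ≤ 1 / (den (e + 1) w Y k : ℝ) := fun k hk =>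
    (hhalf' k hk).trans (one_div_le_one_div_of_le (hYpos k) (by have := hYpos k; linarith))
  have hXs := hXb.summable hβ hsum
  have hYs := hYb.summable hβ hsum
  have hhead : ∑ k ∈ Finset.range n, 1 / (den (e + 1) w X k : ℝ) =
      ∑ k ∈ Finset.range n, 1 / (den (e + 1) w Y k : ℝ) :=
    Finset.sum_congr rfl fun k hk => by
      rw [Finset.mem_range] at hk
      rw [den_congr fun i hi => (hYX_lt i (by omega)).symm]
  have htail : ∑' k, 1 / (den (e + 1) w X (k + (n + 2)) : ℝ) ≤
      ∑' k, 1 / (den (e + 1) w Y (k + (n + 2)) : ℝ) :=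
    Summable.tsum_le_tsum (fun k => hle _ (by omega)) ((summable_nat_add_iff (n + 2)).2 hXs)
      ((summable_nat_add_iff (n + 2)).2 hYs)
  have hP : 0 < den e w X n := den_pos (hXb.pos hβ) n
  have hXn : den (e + 1) w X n = den e w X n * c ^ w e := by
    rw [den_succ, show n + 1 + e = n + e + 1 by omega, hX_eq]
  have hYn : den (e + 1) w Y n = den e w X n * (c + 1) ^ w e := by
    rw [den_succ, show n + 1 + e = n + e + 1 by omega, hY_eq,
      den_congr fun i hi => hYX_lt i (by omega)]
  have hbound : 2 * w e * den (e + 1) w Y (n + 1) ≤ den e w X n * (c ^ w e * c) := by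
    have hQ : den e w Y (n + 1) ≤ den e w γ (n + 1) := den_mono fun i hi => (hYb i (by omega)).2
    have hP' : den e w β n ≤ den e w X n := den_mono fun i hi => (hXb i (by omega)).1
    rw [den_succ, show n + 1 + 1 + e = n + e + 2 by omega, hY_gt _ le_rfl]
    calc 2 * w e * (den e w Y (n + 1) * β (n + e + 2) ^ w e)
        ≤ 2 * w e * (den e w γ (n + 1) * β (n + e + 2) ^ w e) := by gcongr
      _ ≤ den e w β n * β (n + e + 1) ^ w e * β (n + e + 1) := hcond
      _ ≤ den e w X n * c ^ w e * c := by gcongr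
      _ = _ := by ring
  have hloss : 1 / (den (e + 1) w X n : ℝ) - 1 / (den (e + 1) w Y n : ℝ) ≤
      1 / (2 * (den (e + 1) w Y (n + 1) : ℝ)) := by
    have hPR : (0 : ℝ) < den e w X n := by exact_mod_cast hP
    have hcR : (0 : ℝ) < c := by exact_mod_cast hcpos
    rw [hXn, hYn]
    push_cast
    calc 1 / ((den e w X n : ℝ) * (c : ℝ) ^ w e) - 1 / ((den e w X n : ℝ) * ((c : ℝ) + 1) ^ w e)
        = (1 / (c : ℝ) ^ w e - 1 / ((c : ℝ) + 1) ^ w e) / den e w X n := by field_simp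
      _ ≤ (w e / ((c : ℝ) ^ w e * c)) / den e w X n := by
          gcongr
          exact one_div_pow_sub_le hcR _
      _ = w e / (den e w X n * ((c : ℝ) ^ w e * c)) := by field_simp
      _ ≤ _ := by
          rw [div_le_div_iff₀ (by positivity) (by have := hYpos (n + 1); positivity)]
          have : (2 * w e * den (e + 1) w Y (n + 1) : ℝ) ≤ den e w X n * (c ^ w e * c) := by
            exact_mod_cast hbound
          linarith
  have hgain := hhalf' (n + 1) le_rfl
  have htwo : 1 / (den (e + 1) w Y (n + 1) : ℝ) = 2 * (1 / (2 * (den (e + 1) w Y (n + 1) : ℝ))) := by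
    have := (hYpos (n + 1)).ne'
    field_simp
  unfold total
  rw [← hXs.sum_add_tsum_nat_add (n + 2), ← hYs.sum_add_tsum_nat_add (n + 2),
    Finset.sum_range_succ, Finset.sum_range_succ, Finset.sum_range_succ, Finset.sum_range_succ, hhead]
  linarith

lemma eventually_mul_le_of_tendsto_div (hβγ : ∀ n, 1 ≤ n → β n ≤ γ n)
    (hβ : ∀ n, 1 ≤ n → 0 < β n)
    (hratio : Tendsto (fun n : ℕ => (β n : ℝ) / (γ n : ℝ)) atTop (𝓝 0)) {C : ℕ} (hC : 0 < C) :
    ∀ᶠ n in atTop, C * β n ≤ γ n := by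
  have hCR : (0 : ℝ) < C := by exact_mod_cast hC
  filter_upwards [hratio.eventually (gt_mem_nhds (show (0 : ℝ) < 1 / C by positivity)),
    eventually_ge_atTop 1] with n hn hn1
  have hγ : (0 : ℝ) < γ n := by exact_mod_cast (hβ n hn1).trans_le (hβγ n hn1)
  rw [div_lt_div_iff₀ hγ hCR] at hn
  have : (C * β n : ℝ) ≤ γ n := by linarith
  exact_mod_cast this

lemma eventually_den_mul_le (hβγ : ∀ n, 1 ≤ n → β n ≤ γ n) (hβ : ∀ n, 1 ≤ n → 0 < β n)
    (hcond : Tendsto (fun n : ℕ =>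
        (∏ j ∈ Finset.range e, ((β (n + 1 + j) : ℝ) / (γ (n + 2 + j) : ℝ)) ^ w j) *
          ((β (n + (e + 1)) : ℝ) / (β (n + (e + 1) + 1) : ℝ)) ^ w e * (β (n + (e + 1)) : ℝ))
        atTop atTop) (C : ℕ) :
    ∀ᶠ n in atTop, C * (den e w γ (n + 1) * β (n + e + 2) ^ w e) ≤
      den e w β n * β (n + e + 1) ^ w e * β (n + e + 1) := by
  filter_upwards [hcond.eventually_ge_atTop (C : ℝ)] with n hn
  have hγ : (0 : ℝ) < den e w γ (n + 1) := by
    exact_mod_cast den_pos (fun i hi => (hβ i hi).trans_le (hβγ i hi)) _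
  have hb : (0 : ℝ) < β (n + e + 2) := by exact_mod_cast hβ _ (by omega)
  have hprod : (∏ j ∈ Finset.range e, ((β (n + 1 + j) : ℝ) / (γ (n + 2 + j) : ℝ)) ^ w j) =
      den e w β n / den e w γ (n + 1) := by
    simp only [den, Nat.cast_prod, Nat.cast_pow, div_pow, Finset.prod_div_distrib]
  rw [hprod, div_pow, show n + (e + 1) + 1 = n + e + 2 by omega,
    show n + (e + 1) = n + e + 1 by omega, div_mul_div_comm, div_mul_eq_mul_div,
    le_div_iff₀ (by positivity)] at hn
  exact_mod_cast hn

end Overlap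

/-- Finitely many prefixes of length `N` suffice to describe a set that is a union of intervals
depending only on such a prefix. -/
lemma exists_finite_iUnion_Icc {β γ : ℕ → ℕ} (N : ℕ) (L U : (ℕ → ℕ) → ℝ)
    (hL : ∀ a b : ℕ → ℕ, (∀ n, n < N → 1 ≤ n → a n = b n) → L a = L b ∧ U a = U b)
    (hLU : ∀ a, Between β γ a → L a < U a) :
    ∃ (k : ℕ) (u v : Fin k → ℝ), (∀ i, u i < v i) ∧
      {s : ℝ | ∃ a, Between β γ a ∧ s ∈ Set.Icc (L a) (U a)} = ⋃ i, Set.Icc (u i) (v i) := by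
  have hfin : {q : ℝ × ℝ | ∃ a, Between β γ a ∧ q = (L a, U a)}.Finite := by
    refine (Set.finite_range fun p : (i : Fin N) → Fin (γ i + 1) =>
      (L fun n => if h : n < N then p ⟨n, h⟩ else 0, U fun n => if h : n < N then p ⟨n, h⟩ else 0)
      ).subset ?_
    rintro _ ⟨a, ha, rfl⟩
    refine ⟨fun i => Fin.ofNat (γ i + 1) (a i), ?_⟩
    obtain ⟨h₁, h₂⟩ := hL (fun n => if h : n < N then (Fin.ofNat (γ n + 1) (a n) : ℕ) else 0) a
      fun n hn hn1 => by
        have := (ha n hn1).2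
        simp [hn, Nat.mod_eq_of_lt (Nat.lt_succ_of_le this)]
    exact Prod.ext h₁ h₂
  have := hfin.to_subtype
  obtain ⟨k, ⟨f⟩⟩ := Finite.exists_equiv_fin {q : ℝ × ℝ | ∃ a, Between β γ a ∧ q = (L a, U a)}
  refine ⟨k, fun i => (f.symm i).1.1, fun i => (f.symm i).1.2, fun i => ?_, ?_⟩
  · obtain ⟨a, ha, h⟩ := (f.symm i).2
    simpa only [h] using hLU a ha
  · ext s
    rw [Set.mem_iUnion]
    constructor
    · rintro ⟨a, ha, hs⟩
      exact ⟨f ⟨_, a, ha, rfl⟩, by simpa using hs⟩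
    · rintro ⟨i, hi⟩
      obtain ⟨a, ha, h⟩ := (f.symm i).2
      simp only [h] at hi
      exact ⟨a, ha, hi⟩

end WindowSum

open WindowSum

/-- **main technical lemma.** Fix `d ≥ 1` and non-negative integers
`w 0, …, w (d-1)` with `w (d-1) ≥ 1`, and write
`S(a) = ∑_{n≥1} 1/(a_n^{w_0} a_{n+1}^{w_1} ⋯ a_{n+d-1}^{w_{d-1}})`. If `β ≤ γ` are
non-decreasing sequences of positive integers with (i) `S(β) < ∞` (i.e. the series for
`β` is summable), (ii) `β_n/γ_n → 0`, and (iii)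
`(β_n/γ_{n+1})^{w_0} ⋯ (β_{n+d-2}/γ_{n+d-1})^{w_{d-2}} (β_{n+d-1}/β_{n+d})^{w_{d-1}} β_{n+d-1} → ∞`,
then the set `{ S(a) : β_n ≤ a_n ≤ γ_n for every n ≥ 1 }` equals a finite union of
non-degenerate closed bounded intervals `[u_i, v_i]`, `u_i < v_i`. -/
theorem stmt_13 (d : ℕ) (hd : 0 < d) (w : ℕ → ℕ) (hw : 1 ≤ w (d - 1))
    (β γ : ℕ → ℕ) (hβ_pos : ∀ n, 1 ≤ n → 0 < β n)
    (hβ_mono : ∀ n, 1 ≤ n → β n ≤ β (n + 1))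
    (hγ_mono : ∀ n, 1 ≤ n → γ n ≤ γ (n + 1))
    (hβγ : ∀ n, 1 ≤ n → β n ≤ γ n)
    (hsum : Summable fun n : ℕ => 1 / ∏ j ∈ Finset.range d, (β (n + 1 + j) : ℝ) ^ w j)
    (hratio : Tendsto (fun n : ℕ => (β n : ℝ) / (γ n : ℝ)) atTop (𝓝 0))
    (hcond : Tendsto (fun n : ℕ =>
        (∏ j ∈ Finset.range (d - 1), ((β (n + 1 + j) : ℝ) / (γ (n + 2 + j) : ℝ)) ^ w j) *
          ((β (n + d) : ℝ) / (β (n + d + 1) : ℝ)) ^ w (d - 1) * (β (n + d) : ℝ))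
        atTop atTop) :
    ∃ (k : ℕ) (u v : Fin k → ℝ), (∀ i, u i < v i) ∧
      {s : ℝ | ∃ a : ℕ → ℕ, (∀ n, 1 ≤ n → β n ≤ a n ∧ a n ≤ γ n) ∧
          s = ∑' n : ℕ, 1 / ∏ j ∈ Finset.range d, (a (n + 1 + j) : ℝ) ^ w j}
        = ⋃ i, Set.Icc (u i) (v i) := by
  obtain ⟨e, rfl⟩ : ∃ e, d = e + 1 := ⟨d - 1, by omega⟩
  simp only [Nat.add_sub_cancel] at hw hcond
  have hcast : ∀ (a : ℕ → ℕ) (n : ℕ), 1 / ∏ j ∈ Finset.range (e + 1), (a (n + 1 + j) : ℝ) ^ w j =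
      1 / (den (e + 1) w a n : ℝ) := fun a n => by simp [den]
  simp only [hcast] at hsum ⊢
  obtain ⟨M, hM⟩ := eventually_atTop.1
    ((eventually_mul_le_of_tendsto_div hβγ hβ_pos hratio
      (C := 2 ^ (∑ j ∈ Finset.range e, w j + 1)) (by positivity)).and
      (eventually_den_mul_le hβγ hβ_pos hcond (2 * w e)))
  have hb : Between β γ β := fun n hn => ⟨le_rfl, hβγ n hn⟩
  have hg : Between β γ γ := fun n hn => ⟨hβγ n hn, le_rfl⟩
  have hlt : ∀ n, M + e + 1 ≤ n → β n < γ n := fun n hn => by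
    have h₁ := (hM n (by omega)).1
    have h₂ := hβ_pos n (by omega)
    have h₃ : 2 * β n ≤ 2 ^ (∑ j ∈ Finset.range e, w j + 1) * β n :=
      Nat.mul_le_mul_right _ (Nat.le_self_pow (by omega) 2)
    omega
  obtain ⟨k, u, v, huv, h⟩ := exists_finite_iUnion_Icc (β := β) (γ := γ) (M + e + 1)
    (fun a => total (e + 1) w (splice (M + e + 1) a γ))
    (fun a => total (e + 1) w (splice (M + e + 1) a β))
    (fun a b hab => by
      have hden : ∀ g n, den (e + 1) w (splice (M + e + 1) a g) n =
          den (e + 1) w (splice (M + e + 1) b g) n := fun g n =>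
        Finset.prod_congr rfl fun j _ => by
          unfold splice
          split_ifs with hj
          · rw [hab _ hj (by omega)]
          · rfl
      simp only [total, hden, and_self])
    (fun a ha => total_splice_lt (by simpa using hw) hd hβ_pos hβγ hsum ha hlt)
  refine ⟨k, u, v, huv, ?_⟩
  rw [← h]
  ext s
  constructor
  · rintro ⟨a, ha, rfl⟩
    refine ⟨a, ha, total_anti ha (Between.splice ha hg _) hβ_pos hsum fun n hn => ?_,
      total_anti (Between.splice ha hb _) ha hβ_pos hsum fun n hn => ?_⟩
    · unfold splice
      split_ifs
      exacts [le_rfl, (ha n hn).2]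
    · unfold splice
      split_ifs
      exacts [le_rfl, (ha n hn).1]
  · rintro ⟨a, ha, hs₁, hs₂⟩
    obtain ⟨b, hb', hbs⟩ := exists_between_eq (S := total (e + 1) w) (by omega) hβγ
      (fun N hN a ha hlt => by
        obtain ⟨n, rfl⟩ : ∃ n, N = n + e + 1 := ⟨N - e - 1, by omega⟩
        exact total_splice_overlap hw hβ_pos hβγ hsum
          (fun i hi => (hM i (by omega)).1) (hM n (by omega)).2 ha hlt)
      (fun a b ha hb => tendsto_total_splice ha hb hβ_pos hsum) ha hs₁ hs₂
    exact ⟨b, hb', hbs.symm⟩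
end

section
/- Fix a positive integer d and a tuple of non-negative integers w = (w_0, …, w_{d-1}) with w_{d-1} ≥ 1, and for a sequence of positive integers {a_n}_{n=1}^∞ write S({a_n}) = ∑_{n=1}^∞ 1/(a_n^{w_0} a_{n+1}^{w_1} ⋯ a_{n+d-1}^{w_{d-1}}). Let {β_n}_{n=1}^∞ and {γ_n}_{n=1}^∞ be monotonically increasing sequences of positive integers with β_n ≤ γ_n for every n, such that: (i) ∑_{n=1}^∞ 1/(β_n^{w_0} β_{n+1}^{w_1} ⋯ β_{n+d-1}^{w_{d-1}}) < ∞; (ii) lim_{n→∞} β_n/γ_n = 0; and (iii) lim_{n→∞} (β_n/γ_{n+1})^{w_0} ⋯ (β_{n+d-2}/γ_{n+d-1})^{w_{d-2}} · (β_{n+d-1}/β_{n+d})^{w_{d-1}} · β_{n+d-1} = ∞. Then there exists a sequence of positive integers {a_n}_{n=1}^∞ with β_n ≤ a_n ≤ γ_n for every n ∈ ℕ such that S({a_n}) is a rational number. -/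
open Filter Topology

/-- The product `∏_{j < d} (a (n + j)) ^ w j` as a real number. -/
noncomputable def windowProd (w : ℕ → ℕ) (d : ℕ) (a : ℕ → ℕ) (n : ℕ) : ℝ :=
  ∏ j ∈ Finset.range d, (a (n + j) : ℝ) ^ w j

/-- The sequence equal to `a` below `m` and to `b` from `m` on. -/
def splice (a : ℕ → ℕ) (m : ℕ) (b : ℕ → ℕ) : ℕ → ℕ := fun k => if k < m then a k else b k

section WindowProd

variable {w : ℕ → ℕ} {d : ℕ} {a b : ℕ → ℕ}

lemma windowProd_pos (ha : ∀ k, 0 < a k) (n : ℕ) : 0 < windowProd w d a n :=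
  Finset.prod_pos fun j _ => pow_pos (Nat.cast_pos.2 (ha (n + j))) _

lemma windowProd_succ (n : ℕ) :
    windowProd w (d + 1) a n = windowProd w d a n * (a (n + d) : ℝ) ^ w d :=
  Finset.prod_range_succ _ _

lemma windowProd_congr {n : ℕ} (h : ∀ j < d, a (n + j) = b (n + j)) :
    windowProd w d a n = windowProd w d b n :=
  Finset.prod_congr rfl fun j hj => by rw [h j (Finset.mem_range.1 hj)]

lemma windowProd_mono {n : ℕ} (h : ∀ j < d, a (n + j) ≤ b (n + j)) :
    windowProd w d a n ≤ windowProd w d b n :=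
  Finset.prod_le_prod (fun _ _ => by positivity) fun j hj =>
    pow_le_pow_left₀ (by positivity) (Nat.cast_le.2 (h j (Finset.mem_range.1 hj))) _

lemma windowProd_le_two_pow_mul {n : ℕ} (h : ∀ j < d, a (n + j) ≤ 2 * b (n + j)) :
    windowProd w d a n ≤ 2 ^ (∑ j ∈ Finset.range d, w j) * windowProd w d b n := by
  unfold windowProd
  rw [← Finset.prod_pow_eq_pow_sum, ← Finset.prod_mul_distrib]
  refine Finset.prod_le_prod (fun _ _ => by positivity) fun j hj => ?_
  rw [← mul_pow]
  exact pow_le_pow_left₀ (by positivity) (mod_cast h j (Finset.mem_range.1 hj)) _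

/-- A large ratio in the last factor compensates a loss of a factor two in the other ones. -/
lemma two_mul_windowProd_succ_le {n : ℕ} (hw : 1 ≤ w d)
    (h : ∀ j < d, a (n + j) ≤ 2 * b (n + j))
    (hlast : 2 ^ (∑ j ∈ Finset.range d, w j + 1) * a (n + d) ≤ b (n + d)) :
    2 * windowProd w (d + 1) a n ≤ windowProd w (d + 1) b n := by
  have h1 := windowProd_le_two_pow_mul (w := w) h
  rw [windowProd_succ, windowProd_succ]
  set W := ∑ j ∈ Finset.range d, w j
  have hb : (0 : ℝ) ≤ windowProd w d b n := Finset.prod_nonneg fun _ _ => by positivity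
  have h2 : ((2 : ℝ) ^ (W + 1) * a (n + d)) ^ w d ≤ (b (n + d) : ℝ) ^ w d :=
    pow_le_pow_left₀ (by positivity) (mod_cast hlast) _
  have h3 : (2 : ℝ) ^ (W + 1) ≤ (2 ^ (W + 1)) ^ w d :=
    le_self_pow₀ (one_le_pow₀ one_le_two) (by lia)
  calc 2 * (windowProd w d a n * (a (n + d) : ℝ) ^ w d)
      ≤ 2 * ((2 ^ W * windowProd w d b n) * (a (n + d) : ℝ) ^ w d) := by gcongr
    _ = windowProd w d b n * (2 ^ (W + 1) * (a (n + d) : ℝ) ^ w d) := by ring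
    _ ≤ windowProd w d b n * ((2 ^ (W + 1)) ^ w d * (a (n + d) : ℝ) ^ w d) := by gcongr
    _ = windowProd w d b n * (2 ^ (W + 1) * (a (n + d) : ℝ)) ^ w d := by rw [mul_pow]
    _ ≤ windowProd w d b n * (b (n + d) : ℝ) ^ w d := by gcongr

lemma one_div_windowProd_anti (ha : ∀ k, 0 < a k) (h : ∀ k, a k ≤ b k) (n : ℕ) :
    1 / windowProd w d b n ≤ 1 / windowProd w d a n :=
  one_div_le_one_div_of_le (windowProd_pos ha n) (windowProd_mono fun _ _ => h _)

lemma one_div_windowProd_nonneg (n : ℕ) : 0 ≤ 1 / windowProd w d a n :=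
  one_div_nonneg.2 (Finset.prod_nonneg fun _ _ => by positivity)

lemma summable_one_div_windowProd_of_le (ha : ∀ k, 0 < a k) (h : ∀ k, a k ≤ b k)
    (hs : Summable fun n => 1 / windowProd w d a n) :
    Summable fun n => 1 / windowProd w d b n :=
  Summable.of_nonneg_of_le one_div_windowProd_nonneg (one_div_windowProd_anti ha h) hs

/-- Dominated convergence for sequences that stabilise coordinatewise. -/
lemma tendsto_tsum_one_div_windowProd (ha : ∀ k, 0 < a k)
    (hs : Summable fun n => 1 / windowProd w d a n) {B : ℕ → ℕ → ℕ}
    (hB : ∀ i k, a k ≤ B i k) (hlim : ∀ k, ∀ i > k, B i k = b k) :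
    Tendsto (fun i => ∑' n, 1 / windowProd w d (B i) n) atTop
      (𝓝 (∑' n, 1 / windowProd w d b n)) := by
  refine tendsto_tsum_of_dominated_convergence hs (fun n => ?_) (Eventually.of_forall fun i n => ?_)
  · refine tendsto_const_nhds.congr' ?_
    filter_upwards [eventually_gt_atTop (n + d)] with i hi
    rw [windowProd_congr fun j hj => (hlim (n + j) i (by lia)).symm]
  · rw [Real.norm_of_nonneg (one_div_windowProd_nonneg n)]
    exact one_div_windowProd_anti ha (hB i) n

end WindowProd

lemma one_div_pow_sub_one_div_succ_pow_le {c : ℝ} (hc : 0 < c) (p : ℕ) :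
    1 / c ^ p - 1 / (c + 1) ^ p ≤ p / c ^ (p + 1) := by
  have hb : 1 + (p : ℝ) * (-1 / (c + 1)) ≤ (1 + -1 / (c + 1)) ^ p :=
    one_add_mul_le_pow (by rw [le_div_iff₀ (by positivity)]; linarith) p
  have he : 1 + -1 / (c + 1) = c / (c + 1) := by field_simp; ring
  rw [he, div_pow] at hb
  have h1 : (p : ℝ) / (c + 1) ≤ p / c := by gcongr; linarith
  have h2 : 1 - c ^ p / (c + 1) ^ p ≤ p / c := by
    have : (p : ℝ) * (-1 / (c + 1)) = -(p / (c + 1)) := by ring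
    linarith
  calc 1 / c ^ p - 1 / (c + 1) ^ p = (1 - c ^ p / (c + 1) ^ p) * (1 / c ^ p) := by field_simp
    _ ≤ p / c * (1 / c ^ p) := by gcongr
    _ = p / c ^ (p + 1) := by rw [pow_succ]; field_simp

lemma tsum_le_tsum_of_compensated {f g : ℕ → ℝ} (hf : Summable f) (hg : Summable g) (n₀ : ℕ)
    (h : ∀ n ≠ n₀, f n ≤ g n) (h₀ : f n₀ + f (n₀ + 1) ≤ g n₀ + g (n₀ + 1)) :
    ∑' n, f n ≤ ∑' n, g n := by
  have h1 := (hg.sub hf).sum_le_tsum {n₀, n₀ + 1} fun n hn => by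
    have : n ≠ n₀ := by rintro rfl; simp at hn
    linarith [h n this]
  rw [Finset.sum_pair (by lia), hg.tsum_sub hf] at h1
  linarith

section Overlap

variable {w : ℕ → ℕ} {e : ℕ} {β γ : ℕ → ℕ}

/-- Raising the entry at `n + e` by one while replacing all later entries of `γ` by those of `β`
does not decrease the sum. -/
lemma tsum_le_tsum_of_succ (hw : 1 ≤ w e) (hβ : ∀ k, 0 < β k)
    (hsum : Summable fun n => 1 / windowProd w (e + 1) β n) {u v : ℕ → ℕ} {n : ℕ}
    (hβu : ∀ k, β k ≤ u k) (hβv : ∀ k, β k ≤ v k) (hvγ : ∀ k, v k ≤ γ k)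
    (hlt : ∀ k < n + e, u k = v k) (heq : v (n + e) = u (n + e) + 1)
    (hgtu : ∀ k > n + e, u k = γ k) (hgtv : ∀ k > n + e, v k = β k)
    (hratio : ∀ k ≥ n + e, 2 ^ (∑ j ∈ Finset.range e, w j + 1) * β k ≤ γ k)
    (hcond : 2 * (w e : ℝ) * (windowProd w e γ (n + 1) * (β (n + e + 1) : ℝ) ^ w e) ≤
      windowProd w e β n * (β (n + e) : ℝ) ^ (w e + 1)) :
    ∑' i, 1 / windowProd w (e + 1) u i ≤ ∑' i, 1 / windowProd w (e + 1) v i := by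
  have hu : ∀ k, 0 < u k := fun k => (hβ k).trans_le (hβu k)
  have hv : ∀ k, 0 < v k := fun k => (hβ k).trans_le (hβv k)
  have hvu : ∀ k, v k ≤ 2 * u k := by
    intro k
    rcases lt_trichotomy k (n + e) with hk | rfl | hk
    · rw [hlt k hk]; lia
    · have := hu (n + e); lia
    · rw [hgtu k hk]; have := hvγ k; lia
  have hdouble : ∀ i > n, 1 / windowProd w (e + 1) u i ≤ 1 / windowProd w (e + 1) v i / 2 := by
    intro i hi
    have hi' : i + e > n + e := by lia
    have h := two_mul_windowProd_succ_le (a := v) (b := u) (n := i) hw (fun j _ => hvu _)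
      (by rw [hgtu _ hi', hgtv _ hi']; exact hratio _ hi'.le)
    have hp := windowProd_pos (w := w) (d := e + 1) hv i
    rw [div_div, mul_comm]
    exact one_div_le_one_div_of_le (by positivity) h
  have hloss : 1 / windowProd w (e + 1) u n - 1 / windowProd w (e + 1) v n ≤
      1 / windowProd w (e + 1) v (n + 1) / 2 := by
    have hP : windowProd w e u n = windowProd w e v n :=
      windowProd_congr fun j hj => hlt _ (by lia)
    have hPpos := windowProd_pos (w := w) (d := e) hv n
    have hQpos := windowProd_pos (w := w) (d := e) hv (n + 1)
    have hPβ : windowProd w e β n ≤ windowProd w e v n := windowProd_mono fun _ _ => hβv _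
    have hQγ : windowProd w e v (n + 1) ≤ windowProd w e γ (n + 1) :=
      windowProd_mono fun _ _ => hvγ _
    have hidx : n + 1 + e = n + e + 1 := by lia
    rw [windowProd_succ, windowProd_succ, windowProd_succ, hP, heq, hidx, hgtv _ (Nat.lt_succ_self _)]
    have hb : (0 : ℝ) < β (n + e + 1) := Nat.cast_pos.2 (hβ _)
    have hc : (0 : ℝ) < u (n + e) := Nat.cast_pos.2 (hu _)
    have hcβ : (β (n + e) : ℝ) ≤ u (n + e) := Nat.cast_le.2 (hβu _)
    set P := windowProd w e v n
    set Q := windowProd w e v (n + 1)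
    set c : ℝ := (u (n + e) : ℝ)
    have hkey : 2 * (w e : ℝ) * (Q * (β (n + e + 1) : ℝ) ^ w e) ≤ P * c ^ (w e + 1) :=
      calc _ ≤ 2 * (w e : ℝ) * (windowProd w e γ (n + 1) * (β (n + e + 1) : ℝ) ^ w e) := by gcongr
        _ ≤ _ := hcond
        _ ≤ _ := by gcongr
    have h1 := one_div_pow_sub_one_div_succ_pow_le hc (w e)
    push_cast
    calc 1 / (P * c ^ w e) - 1 / (P * (c + 1) ^ w e)
        = 1 / P * (1 / c ^ w e - 1 / (c + 1) ^ w e) := by field_simp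
      _ ≤ 1 / P * (w e / c ^ (w e + 1)) := by gcongr
      _ = w e / (P * c ^ (w e + 1)) := by rw [div_mul_div_comm, one_mul]
      _ ≤ 1 / (Q * (β (n + e + 1) : ℝ) ^ w e) / 2 := by
        rw [div_div, div_le_div_iff₀ (by positivity) (by positivity)]
        linarith
  refine tsum_le_tsum_of_compensated (summable_one_div_windowProd_of_le hβ hβu hsum)
    (summable_one_div_windowProd_of_le hβ hβv hsum) n (fun i hi => ?_) ?_
  · rcases lt_or_gt_of_ne hi with hi | hi
    · rw [windowProd_congr fun j hj => hlt (i + j) (by lia)]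
    · linarith [hdouble i hi, one_div_windowProd_nonneg (w := w) (d := e + 1) (a := v) i]
  · linarith [hdouble (n + 1) (Nat.lt_succ_self n)]

/-- If neighbouring intervals of values overlap, an admissible prefix for the target `x` can be
prolonged by one entry. -/
lemma exists_prolongation {F : (ℕ → ℕ) → ℝ} {x : ℝ} {a : ℕ → ℕ} {m : ℕ}
    (haβ : ∀ k, β k ≤ a k) (haγ : ∀ k, a k ≤ γ k)
    (hmin : F (splice a m γ) ≤ x) (hmax : x ≤ F (splice a m β))
    (hstep : ∀ c, β m ≤ c → c + 1 ≤ γ m →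
      F (splice (Function.update a m c) (m + 1) γ) ≤
        F (splice (Function.update a m (c + 1)) (m + 1) β)) :
    ∃ a' : ℕ → ℕ, (∀ k < m, a' k = a k) ∧ (∀ k, β k ≤ a' k) ∧ (∀ k, a' k ≤ γ k) ∧
      F (splice a' (m + 1) γ) ≤ x ∧ x ≤ F (splice a' (m + 1) β) := by
  have hend : ∀ b : ℕ → ℕ, splice (Function.update a m (b m)) (m + 1) b = splice a m b := by
    intro b
    funext k
    rcases lt_trichotomy k m with hk | rfl | hk
    · simp [splice, hk, hk.ne, hk.trans (Nat.lt_succ_self m)]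
    · simp [splice]
    · simp [splice, hk.not_gt, show ¬ k < m + 1 by lia]
  have hβγ : β m ≤ γ m := (haβ m).trans (haγ m)
  have hex : ∃ c, β m ≤ c ∧ F (splice (Function.update a m c) (m + 1) γ) ≤ x :=
    ⟨γ m, hβγ, by rwa [hend]⟩
  classical
  obtain ⟨hc1, hc2⟩ := Nat.find_spec hex
  have hcγ : Nat.find hex ≤ γ m := Nat.find_min' hex ⟨hβγ, by rwa [hend]⟩
  have hfmin := fun {c} => Nat.find_min hex (m := c)
  set c := Nat.find hex
  refine ⟨Function.update a m c, fun k hk => Function.update_of_ne hk.ne _ _, fun k => ?_,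
    fun k => ?_, hc2, ?_⟩
  · rcases eq_or_ne k m with rfl | hk
    · simpa using hc1
    · simpa [hk] using haβ k
  · rcases eq_or_ne k m with rfl | hk
    · simpa using hcγ
    · simpa [hk] using haγ k
  · rcases hc1.eq_or_lt with h | h
    · rw [← h, hend]; exact hmax
    · obtain ⟨c', hc'⟩ : ∃ c', c = c' + 1 := ⟨c - 1, by lia⟩
      have h1 : ¬ (β m ≤ c' ∧ _) := hfmin (by lia)
      have h2 := hstep c' (by lia) (by lia)
      rw [hc']
      refine le_trans (le_of_lt ?_) h2
      by_contra hcon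
      exact h1 ⟨by lia, not_lt.1 hcon⟩

/-- Iterating one-step prolongations of sequences produces a limit sequence. -/
lemma exists_stable_limit {P : ℕ → (ℕ → ℕ) → Prop} {M : ℕ} {a₀ : ℕ → ℕ} (h₀ : P M a₀)
    (hstep : ∀ m ≥ M, ∀ a, P m a → ∃ a', (∀ k < m, a' k = a k) ∧ P (m + 1) a') :
    ∃ (A : ℕ → ℕ → ℕ) (a : ℕ → ℕ), (∀ i, P (M + i) (A i)) ∧ ∀ k, ∀ i > k, A i k = a k := by
  choose f hf hP using hstep
  let A : ∀ i, {a : ℕ → ℕ // P (M + i) a} := fun i =>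
    Nat.rec ⟨a₀, h₀⟩ (fun i s => ⟨f (M + i) (by lia) s.1 s.2, hP (M + i) (by lia) s.1 s.2⟩) i
  refine ⟨fun i => (A i).1, fun k => (A (k + 1)).1 k, fun i => (A i).2, fun k i hi => ?_⟩
  induction i, hi using Nat.le_induction with
  | base => rfl
  | succ i hi ih =>
    rw [← ih]
    exact hf (M + i) (by lia) (A i).1 (A i).2 k (by lia)

/-- The result for sequences indexed from zero. -/
lemma exists_rational_tsum (hw : 1 ≤ w e) (hβ : ∀ k, 0 < β k) (hβγ : ∀ k, β k ≤ γ k)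
    (hsum : Summable fun n => 1 / windowProd w (e + 1) β n)
    (hratio : Tendsto (fun n => (β n : ℝ) / (γ n : ℝ)) atTop (𝓝 0))
    (hcond : Tendsto (fun n =>
      (∏ j ∈ Finset.range e, ((β (n + j) : ℝ) / (γ (n + 1 + j) : ℝ)) ^ w j) *
        ((β (n + e) : ℝ) / (β (n + e + 1) : ℝ)) ^ w e * (β (n + e) : ℝ)) atTop atTop) :
    ∃ a : ℕ → ℕ, (∀ n, β n ≤ a n ∧ a n ≤ γ n) ∧
      ∃ q : ℚ, ∑' n, 1 / windowProd w (e + 1) a n = q := by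
  have hγ : ∀ k, 0 < γ k := fun k => (hβ k).trans_le (hβγ k)
  set W := ∑ j ∈ Finset.range e, w j
  obtain ⟨N₁, hN₁⟩ : ∃ N, ∀ k ≥ N, 2 ^ (W + 1) * β k ≤ γ k := by
    have h : ∀ᶠ k in atTop, (β k : ℝ) / γ k < 1 / 2 ^ (W + 1) :=
      hratio.eventually_lt_const (by positivity)
    obtain ⟨N, hN⟩ := eventually_atTop.1 h
    refine ⟨N, fun k hk => ?_⟩
    have h1 := hN k hk
    rw [div_lt_div_iff₀ (Nat.cast_pos.2 (hγ k)) (by positivity)] at h1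
    have h2 : 2 ^ (W + 1) * (β k : ℝ) ≤ γ k := by linarith
    exact_mod_cast h2
  obtain ⟨N₂, hN₂⟩ : ∃ N, ∀ n ≥ N,
      2 * (w e : ℝ) * (windowProd w e γ (n + 1) * (β (n + e + 1) : ℝ) ^ w e) ≤
        windowProd w e β n * (β (n + e) : ℝ) ^ (w e + 1) := by
    obtain ⟨N, hN⟩ := eventually_atTop.1 (hcond.eventually_ge_atTop (2 * (w e : ℝ)))
    refine ⟨N, fun n hn => ?_⟩
    have h1 := hN n hn
    have hprod : (∏ j ∈ Finset.range e, ((β (n + j) : ℝ) / (γ (n + 1 + j) : ℝ)) ^ w j) =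
        windowProd w e β n / windowProd w e γ (n + 1) := by
      simp only [windowProd, div_pow, Finset.prod_div_distrib]
    have hpos := windowProd_pos (w := w) (d := e) hγ (n + 1)
    have hb : (0 : ℝ) < β (n + e + 1) := Nat.cast_pos.2 (hβ _)
    rw [hprod, div_pow, div_mul_div_comm, div_mul_eq_mul_div, le_div_iff₀ (by positivity)] at h1
    rw [pow_succ, ← mul_assoc (windowProd w e β n)]
    exact h1
  set M := max N₁ (N₂ + e)
  have hN₁M : N₁ ≤ M := le_max_left _ _
  have hN₂M : N₂ + e ≤ M := le_max_right _ _
  let F : (ℕ → ℕ) → ℝ := fun a => ∑' n, 1 / windowProd w (e + 1) a n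
  have hspl : ∀ {a b : ℕ → ℕ} (m : ℕ), (∀ k, β k ≤ a k) → (∀ k, β k ≤ b k) →
      ∀ k, β k ≤ splice a m b k := by
    intro a b m ha hb k
    unfold splice
    split_ifs
    exacts [ha k, hb k]
  have hgap : F (splice β M γ) < F (splice β M β) := by
    have hself : splice β M β = β := by funext k; simp [splice]
    rw [hself]
    have hle := hspl (b := γ) M (fun k => le_refl (β k)) hβγ
    refine Summable.tsum_lt_tsum (i := M) (one_div_windowProd_anti hβ hle) ?_
      (summable_one_div_windowProd_of_le hβ hle hsum) hsum
    have h := two_mul_windowProd_succ_le (a := β) (b := splice β M γ) (n := M) hw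
      (fun j _ => by have := hle (M + j); lia) (by simpa [splice] using hN₁ (M + e) (by lia))
    have hp := windowProd_pos (w := w) (d := e + 1) hβ M
    exact one_div_lt_one_div_of_lt hp (by linarith)
  obtain ⟨q, hq1, hq2⟩ := exists_rat_btwn hgap
  obtain ⟨A, a, hA, hlim⟩ := exists_stable_limit
    (P := fun m a => (∀ k, β k ≤ a k) ∧ (∀ k, a k ≤ γ k) ∧
      F (splice a m γ) ≤ q ∧ (q : ℝ) ≤ F (splice a m β))
    (M := M) (a₀ := β) ⟨fun _ => le_rfl, hβγ, hq1.le, hq2.le⟩ (by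
      rintro m hm a ⟨haβ, haγ, hmin, hmax⟩
      refine exists_prolongation haβ haγ hmin hmax fun c hc hc' => ?_
      obtain ⟨n, rfl⟩ : ∃ n, m = n + e := ⟨m - e, by lia⟩
      have hup : ∀ c, β (n + e) ≤ c → ∀ k, β k ≤ Function.update a (n + e) c k := by
        intro c hc k
        rcases eq_or_ne k (n + e) with rfl | hk
        · simpa using hc
        · simpa [hk] using haβ k
      refine tsum_le_tsum_of_succ (γ := γ) (n := n) hw hβ hsum
        (hspl _ (hup c hc) hβγ) (hspl _ (hup (c + 1) (by lia)) fun _ => le_rfl)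
        (fun k => ?_) (fun k hk => ?_) ?_ (fun k hk => ?_) (fun k hk => ?_)
        (fun k hk => hN₁ k (by lia)) (hN₂ n (by lia))
      · unfold splice
        split_ifs
        · rcases eq_or_ne k (n + e) with rfl | hk
          · simpa using hc'
          · simpa [hk] using haγ k
        · exact hβγ k
      · simp [splice, hk.ne, hk.le]
      · simp [splice]
      · simp [splice, show ¬ k < n + e + 1 by lia]
      · simp [splice, show ¬ k < n + e + 1 by lia])
  have hspllim : ∀ b k, ∀ i > k, splice (A i) (M + i) b k = a k := by
    intro b k i hi
    rw [← hlim k i hi]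
    simp [splice, show k < M + i by lia]
  have hlo := tendsto_tsum_one_div_windowProd hβ hsum
    (fun i => hspl (M + i) (hA i).1 hβγ) (hspllim γ)
  have hhi := tendsto_tsum_one_div_windowProd hβ hsum
    (fun i => hspl (M + i) (hA i).1 fun k => le_refl (β k)) (hspllim β)
  refine ⟨a, fun k => ?_, q, le_antisymm ?_ ?_⟩
  · rw [← hlim k (k + 1) (Nat.lt_succ_self k)]
    exact ⟨(hA _).1 k, (hA _).2.1 k⟩
  · exact le_of_tendsto' hlo fun i => (hA i).2.2.1
  · exact ge_of_tendsto' hhi fun i => (hA i).2.2.2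

end Overlap

/-- Fix `d ≥ 1` and non-negative integers `w 0, …, w (d-1)` with
`w (d-1) ≥ 1`, and write `S(a) = ∑_{n≥1} 1/(a_n^{w_0} a_{n+1}^{w_1} ⋯ a_{n+d-1}^{w_{d-1}})`.
If `β ≤ γ` are non-decreasing sequences of positive integers with (i) the series for `β`
summable, (ii) `β_n/γ_n → 0`, and (iii)
`(β_n/γ_{n+1})^{w_0} ⋯ (β_{n+d-2}/γ_{n+d-1})^{w_{d-2}} (β_{n+d-1}/β_{n+d})^{w_{d-1}} β_{n+d-1} → ∞`,
then there is a sequence of positive integers `a` with `β_n ≤ a_n ≤ γ_n` for all `n ≥ 1`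
such that `S(a)` is rational. -/
theorem stmt_14 (d : ℕ) (hd : 0 < d) (w : ℕ → ℕ) (hw : 1 ≤ w (d - 1))
    (β γ : ℕ → ℕ) (hβ_pos : ∀ n, 1 ≤ n → 0 < β n)
    (hβ_mono : ∀ n, 1 ≤ n → β n ≤ β (n + 1))
    (hγ_mono : ∀ n, 1 ≤ n → γ n ≤ γ (n + 1))
    (hβγ : ∀ n, 1 ≤ n → β n ≤ γ n)
    (hsum : Summable fun n : ℕ => 1 / ∏ j ∈ Finset.range d, (β (n + 1 + j) : ℝ) ^ w j)
    (hratio : Tendsto (fun n : ℕ => (β n : ℝ) / (γ n : ℝ)) atTop (𝓝 0))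
    (hcond : Tendsto (fun n : ℕ =>
        (∏ j ∈ Finset.range (d - 1), ((β (n + 1 + j) : ℝ) / (γ (n + 2 + j) : ℝ)) ^ w j) *
          ((β (n + d) : ℝ) / (β (n + d + 1) : ℝ)) ^ w (d - 1) * (β (n + d) : ℝ))
        atTop atTop) :
    ∃ a : ℕ → ℕ, (∀ n, 1 ≤ n → β n ≤ a n ∧ a n ≤ γ n) ∧
      ∃ q : ℚ, (∑' n : ℕ, 1 / ∏ j ∈ Finset.range d, (a (n + 1 + j) : ℝ) ^ w j) = q := by
  obtain ⟨e, rfl⟩ : ∃ e, d = e + 1 := ⟨d - 1, by lia⟩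
  simp only [Nat.add_sub_cancel] at hw hcond
  have hsum' : Summable fun n =>
      1 / windowProd w (e + 1) (fun k => β (k + 1)) n := by
    refine hsum.congr fun n => ?_
    simp only [windowProd, add_right_comm n 1]
  obtain ⟨a, ha, q, hq⟩ := exists_rational_tsum (w := w) (e := e)
    (β := fun k => β (k + 1)) (γ := fun k => γ (k + 1)) hw
    (fun k => hβ_pos _ (Nat.succ_pos k)) (fun k => hβγ _ (Nat.succ_pos k)) hsum'
    (hratio.comp (tendsto_add_atTop_nat 1)) (hcond.congr fun n => by
      congr! 2
      refine Finset.prod_congr rfl fun j _ => ?_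
      rw [show n + 1 + j = n + j + 1 by lia, show n + 2 + j = n + j + 1 + 1 by lia])
  refine ⟨fun n => a (n - 1), fun n hn => ?_, q, ?_⟩
  · simpa [Nat.sub_add_cancel hn] using ha (n - 1)
  · rw [← hq]
    refine tsum_congr fun n => ?_
    simp only [windowProd, add_right_comm n 1, Nat.add_sub_cancel]
end

section
/- Fix a positive integer d and a tuple of non-negative integers w = (w_0, w_1, …, w_{d-1}) with w_{d-1} ≥ 1, and set W = max{w_0, …, w_{d-1}}. Then the polynomial P_w(x) = (x-1)·∑_{j=0}^{d-1} w_j x^j − W·x^{d-1} has exactly one positive real root, and this root lies in the open interval (1, ∞). -/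
open Filter Topology

/-- The polynomial `P_w` equals `(x - 1) * Q x - W`, where, if all `w j ≤ W`, `Q` has a single
positive coefficient, the leading one. -/
lemma mul_sum_sub_eq_mul_sub (n : ℕ) (w : ℕ → ℝ) (W x : ℝ) :
    (x - 1) * ∑ j ∈ Finset.range (n + 1), w j * x ^ j - W * x ^ n =
      (x - 1) * (w n * x ^ n - ∑ j ∈ Finset.range n, (W - w j) * x ^ j) - W := by
  have hgeom := mul_geom_sum x n
  simp only [sub_mul, Finset.sum_sub_distrib, ← Finset.mul_sum, Finset.sum_range_succ]
  linear_combination W * hgeom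

/-- A polynomial `a * x ^ n - ∑ j < n, b j * x ^ j` with `b j ≥ 0` divided by `x ^ n` is monotone
on the positive reals. -/
lemma sub_sum_mul_pow_le {n : ℕ} {b : ℕ → ℝ} (a : ℝ) (hb : ∀ j < n, 0 ≤ b j) {x y : ℝ}
    (hx : 0 < x) (hxy : x ≤ y) :
    (a * x ^ n - ∑ j ∈ Finset.range n, b j * x ^ j) * y ^ n ≤
      (a * y ^ n - ∑ j ∈ Finset.range n, b j * y ^ j) * x ^ n := by
  have hsum : (∑ j ∈ Finset.range n, b j * y ^ j) * x ^ n ≤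
      (∑ j ∈ Finset.range n, b j * x ^ j) * y ^ n := by
    rw [Finset.sum_mul, Finset.sum_mul]
    refine Finset.sum_le_sum fun j hj => ?_
    have hjn := Finset.mem_range.1 hj
    obtain ⟨k, rfl⟩ := Nat.exists_eq_add_of_lt hjn
    have hy : 0 < y := hx.trans_le hxy
    have hpow : x ^ (k + 1) ≤ y ^ (k + 1) := pow_le_pow_left₀ hx.le hxy _
    have hcoef : 0 ≤ b j * x ^ j * y ^ j := by
      have := hb j hjn
      positivity
    calc b j * y ^ j * x ^ (j + k + 1) = b j * x ^ j * y ^ j * x ^ (k + 1) := by ring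
      _ ≤ b j * x ^ j * y ^ j * y ^ (k + 1) := mul_le_mul_of_nonneg_left hpow hcoef
      _ = b j * x ^ j * y ^ (j + k + 1) := by ring
  linarith

/-- If `0 < W` and all `w j ≤ W`, then `P_w` is positive to the right of any root in `(1, ∞)`. -/
lemma pos_of_root_lt {n : ℕ} {w : ℕ → ℝ} {W : ℝ} (hW : 0 < W) (hw : ∀ j < n, w j ≤ W) {x y : ℝ}
    (hx : 1 < x) (hxy : x < y)
    (hroot : (x - 1) * ∑ j ∈ Finset.range (n + 1), w j * x ^ j - W * x ^ n = 0) :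
    0 < (y - 1) * ∑ j ∈ Finset.range (n + 1), w j * y ^ j - W * y ^ n := by
  rw [mul_sum_sub_eq_mul_sub] at hroot ⊢
  have hle := sub_sum_mul_pow_le (w n) (fun j hj => sub_nonneg.2 (hw j hj))
    (zero_lt_one.trans hx) hxy.le
  set p := w n * x ^ n - ∑ j ∈ Finset.range n, (W - w j) * x ^ j
  set q := w n * y ^ n - ∑ j ∈ Finset.range n, (W - w j) * y ^ j
  have hp : 0 < p := pos_of_mul_pos_right (by linarith : 0 < (x - 1) * p) (by linarith)
  have hpow : x ^ n ≤ y ^ n := pow_le_pow_left₀ (by linarith) hxy.le _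
  have hpq : p ≤ q := le_of_mul_le_mul_right
    ((mul_le_mul_of_nonneg_left hpow hp.le).trans hle) (pow_pos (by linarith) n)
  nlinarith [mul_pos (sub_pos.2 hxy) hp, mul_nonneg (sub_nonneg.2 hpq) (by linarith : 0 ≤ y - 1)]

/-- Fix `d ≥ 1` and non-negative integers `w 0, …, w (d-1)` with
`w (d-1) ≥ 1`, and set `W = max {w 0, …, w (d-1)}`. Then the polynomial
`P_w(x) = (x-1)·∑_{j<d} w_j x^j − W x^(d-1)` has exactly one positive real root, and
this root lies in `(1, ∞)`. -/
theorem stmt_15 (d : ℕ) (hd : 0 < d) (w : ℕ → ℕ) (hw : 1 ≤ w (d - 1)) :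
    ∃ c : ℝ, 1 < c ∧
      ((c - 1) * ∑ j ∈ Finset.range d, (w j : ℝ) * c ^ j
          - (((Finset.range d).sup w : ℕ) : ℝ) * c ^ (d - 1) = 0) ∧
      ∀ x : ℝ, 0 < x →
        (x - 1) * ∑ j ∈ Finset.range d, (w j : ℝ) * x ^ j
            - (((Finset.range d).sup w : ℕ) : ℝ) * x ^ (d - 1) = 0 → x = c := by
  obtain ⟨n, rfl⟩ := Nat.exists_eq_add_of_lt hd
  simp only [zero_add, Nat.add_sub_cancel] at hw ⊢
  have hle : ∀ j < n + 1, (w j : ℝ) ≤ (((Finset.range (n + 1)).sup w : ℕ) : ℝ) := fun j hj =>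
    Nat.cast_le.2 (Finset.le_sup (Finset.mem_range.2 hj))
  generalize (((Finset.range (n + 1)).sup w : ℕ) : ℝ) = W at hle ⊢
  have hwn : (1 : ℝ) ≤ w n := Nat.one_le_cast.2 hw
  have hW : 0 < W := by linarith [hle n n.lt_succ_self]
  have hle' : ∀ j < n, (w j : ℝ) ≤ W := fun j hj => hle j (hj.trans n.lt_succ_self)
  have one_lt_of_root : ∀ x : ℝ, 0 < x →
      (x - 1) * ∑ j ∈ Finset.range (n + 1), (w j : ℝ) * x ^ j - W * x ^ n = 0 → 1 < x := by
    intro x hx hroot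
    by_contra! hx1
    have hsum : 0 ≤ ∑ j ∈ Finset.range (n + 1), (w j : ℝ) * x ^ j := by positivity
    have hpos : 0 < W * x ^ n := by positivity
    nlinarith [mul_nonneg (sub_nonneg.2 hx1) hsum]
  have hright : 0 ≤ (1 + W - 1) * ∑ j ∈ Finset.range (n + 1), (w j : ℝ) * (1 + W) ^ j
      - W * (1 + W) ^ n := by
    have hsum : (1 + W) ^ n ≤ ∑ j ∈ Finset.range (n + 1), (w j : ℝ) * (1 + W) ^ j := by
      rw [Finset.sum_range_succ]
      have hrest : 0 ≤ ∑ j ∈ Finset.range n, (w j : ℝ) * (1 + W) ^ j := by positivity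
      linarith [le_mul_of_one_le_left (by positivity : 0 ≤ (1 + W) ^ n) hwn]
    linarith [mul_le_mul_of_nonneg_left hsum hW.le]
  obtain ⟨c, hc, hroot⟩ := intermediate_value_Icc (by linarith : 1 ≤ 1 + W)
    (f := fun x : ℝ => (x - 1) * ∑ j ∈ Finset.range (n + 1), (w j : ℝ) * x ^ j - W * x ^ n)
    (by fun_prop) ⟨by simpa using hW.le, hright⟩
  have hc1 := one_lt_of_root c (by linarith [hc.1]) hroot
  refine ⟨c, hc1, hroot, fun x hx hxroot => ?_⟩
  rcases lt_trichotomy x c with h | h | h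
  · exact absurd hroot (pos_of_root_lt hW hle' (one_lt_of_root x hx hxroot) h hxroot).ne'
  · exact h
  · exact absurd hxroot (pos_of_root_lt hW hle' hc1 h hroot).ne'
end
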